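/- arXiv:1906.09654 — 3 statements merged into one kernel-verified Lean document; each statement's English description precedes it below -/
import Mathlib

section
/- Let k ≥ 2 and L ≥ 2 be integers, and let h ∈ F_k be a cyclically reduced element containing every reduced word of length L as a subword. Suppose there are a group A, subgroups C and C' of A, an isomorphism ψ : C → C' with C free of rank r, and an isomorphism Φ from F_k to the HNN extension A*_ψ = ⟨A, t | t c t^{-1} = ψ(c) for all c ∈ C⟩, such that Φ(h) lies in a conjugate of the canonical image of A in A*_ψ. Then r > (k−1)(L−2). -/
/-- `g` is cyclically reduced: the concatenation of its reduced word with itself is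
reduced (equivalently, the last letter is not the inverse of the first). -/
def IsCyclicallyReduced {k : ℕ} (g : FreeGroup (Fin k)) : Prop :=
  FreeGroup.reduce (FreeGroup.toWord g ++ FreeGroup.toWord g) =
    FreeGroup.toWord g ++ FreeGroup.toWord g

/-- A tree on the vertex set `V` with oriented edges and a chosen root, described by its parent
and depth functions. -/
structure OrientedTree (V : Type*) where
  /-- `edge x y` says that there is an oriented edge from `x` to `y`. -/
  edge : V → V → Prop
  /-- The neighbour of a vertex in the direction of the root. -/
  parent : V → V
  /-- The distance to the root. -/
  depth : V → ℕ
  eq_of_depth_eq_zero : ∀ x y, depth x = 0 → depth y = 0 → x = y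
  depth_parent : ∀ x, depth x ≠ 0 → depth (parent x) + 1 = depth x
  edge_parent : ∀ x, depth x ≠ 0 → edge x (parent x) ∨ edge (parent x) x
  parent_of_edge : ∀ x y, edge x y →
    (depth x ≠ 0 ∧ parent x = y) ∨ (depth y ≠ 0 ∧ parent y = x)
  edge_asymm : ∀ x y, edge x y → ¬ edge y x

namespace OrientedTree

open Relation

variable {V : Type*} (T : OrientedTree V)

/-- Adjacency inside a set of vertices. -/
def AdjIn (S : Finset V) (x y : V) : Prop :=
  x ∈ S ∧ y ∈ S ∧ (T.edge x y ∨ T.edge y x)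

/-- A finite set of vertices is preconnected if it spans a connected subgraph or is empty. -/
def Preconnected (S : Finset V) : Prop :=
  ∀ x ∈ S, ∀ y ∈ S, ReflTransGen (T.AdjIn S) x y

/-- `S` is a subtree whose vertex closest to the root is `t`. -/
def IsTop (S : Finset V) (t : V) : Prop :=
  t ∈ S ∧ ∀ x ∈ S, x ≠ t → T.depth t < T.depth x ∧ T.parent x ∈ S

variable {T}

theorem AdjIn.symm {S : Finset V} {x y : V} (h : T.AdjIn S x y) : T.AdjIn S y x :=
  ⟨h.2.1, h.1, h.2.2.symm⟩

theorem AdjIn.mono {S S' : Finset V} (hS : S ⊆ S') {x y : V} (h : T.AdjIn S x y) :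
    T.AdjIn S' x y :=
  ⟨hS h.1, hS h.2.1, h.2.2⟩

theorem Preconnected.exists_isTop {S : Finset V} (hS : T.Preconnected S) (hne : S.Nonempty) :
    ∃ t, T.IsTop S t := by
  obtain ⟨t, ht, hmin⟩ := S.exists_min_image T.depth hne
  refine ⟨t, ht, fun x hx hxt => ?_⟩
  have key : ∀ y, ReflTransGen (T.AdjIn S) t y →
      ReflTransGen (fun a b => a ∈ S ∧ T.depth b ≠ 0 ∧ T.parent b = a) t y := by
    intro y hy
    induction hy with
    | refl => exact .refl
    | @tail a b _ hab ih =>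
      obtain ⟨ha, hb, hab⟩ := hab
      have hcase : (T.depth a ≠ 0 ∧ T.parent a = b) ∨ (T.depth b ≠ 0 ∧ T.parent b = a) := by
        rcases hab with h | h
        · exact T.parent_of_edge _ _ h
        · exact (T.parent_of_edge _ _ h).symm
      rcases hcase with ⟨h0, h1⟩ | ⟨h0, h1⟩
      · rcases ih.cases_tail with h | ⟨c, hc, -, -, hca⟩
        · have hd := T.depth_parent a h0
          have hmb := hmin b hb
          rw [h1, h] at hd
          omega
        · rwa [← h1, hca]
      · exact ih.tail ⟨ha, h0, h1⟩
  rcases (key x (hS t ht x hx)).cases_tail with h | ⟨c, -, hc, h0, h1⟩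
  · exact absurd h hxt
  · have hd := T.depth_parent x h0
    have := hmin c hc
    rw [h1] at hd ⊢
    exact ⟨by omega, hc⟩

theorem IsTop.preconnected {S : Finset V} {t : V} (ht : T.IsTop S t) : T.Preconnected S := by
  have key : ∀ n, ∀ x ∈ S, T.depth x = n → ReflTransGen (T.AdjIn S) t x := by
    intro n
    induction n using Nat.strong_induction_on with
    | _ n ih =>
      intro x hx hn
      by_cases hxt : x = t
      · exact hxt ▸ .refl
      · obtain ⟨hlt, hp⟩ := ht.2 x hx hxt
        have h0 : T.depth x ≠ 0 := by omega
        have hd := T.depth_parent x h0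
        exact (ih _ (by omega) _ hp rfl).tail ⟨hp, hx, (T.edge_parent x h0).symm⟩
  intro x hx y hy
  refine ReflTransGen.trans ?_ (key _ y hy rfl)
  have : Std.Symm (T.AdjIn S) := ⟨fun _ _ h => h.symm⟩
  exact symm (key _ x hx rfl)

open Classical in
/-- The oriented edges spanned by a set of vertices. -/
noncomputable def edges (T : OrientedTree V) (S : Finset V) : Finset (V × V) :=
  (S ×ˢ S).filter fun p => T.edge p.1 p.2

theorem mem_edges {S : Finset V} {p : V × V} :
    p ∈ T.edges S ↔ p.1 ∈ S ∧ p.2 ∈ S ∧ T.edge p.1 p.2 := by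
  simp [edges, and_assoc]

section DecidableEq

variable [DecidableEq V]

theorem IsTop.mem_of_depth_le {S S' : Finset V} {t t' : V} (ht : T.IsTop S t)
    (ht' : T.IsTop S' t') (hle : T.depth t ≤ T.depth t') (hne : (S ∩ S').Nonempty) : t' ∈ S := by
  obtain ⟨y, hy, hmin⟩ := (S ∩ S').exists_min_image T.depth hne
  rw [Finset.mem_inter] at hy
  by_cases hyt : y = t'
  · exact hyt ▸ hy.1
  · obtain ⟨h1, h2⟩ := ht'.2 y hy.2 hyt
    obtain ⟨-, h3⟩ := ht.2 y hy.1 (by rintro rfl; omega)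
    have := hmin _ (Finset.mem_inter.2 ⟨h3, h2⟩)
    have := T.depth_parent y (by omega)
    omega

theorem Preconnected.inter {S S' : Finset V} (hS : T.Preconnected S) (hS' : T.Preconnected S') :
    T.Preconnected (S ∩ S') := by
  rcases (S ∩ S').eq_empty_or_nonempty with he | hne
  · simp [Preconnected, he]
  obtain ⟨t, ht⟩ := hS.exists_isTop (hne.mono Finset.inter_subset_left)
  obtain ⟨t', ht'⟩ := hS'.exists_isTop (hne.mono Finset.inter_subset_right)
  wlog hle : T.depth t ≤ T.depth t' generalizing S S' t t'
  · rw [Finset.inter_comm] at hne ⊢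
    exact this hS' hS hne t' ht' t ht (by omega)
  have hmem := ht.mem_of_depth_le ht' hle hne
  refine IsTop.preconnected (t := t') ⟨Finset.mem_inter.2 ⟨hmem, ht'.1⟩, fun x hx hxt => ?_⟩
  rw [Finset.mem_inter] at hx
  obtain ⟨h1, h2⟩ := ht'.2 x hx.2 hxt
  obtain ⟨-, h3⟩ := ht.2 x hx.1 (by rintro rfl; omega)
  exact ⟨h1, Finset.mem_inter.2 ⟨h3, h2⟩⟩

/-- Helly's theorem for subtrees of a tree. -/
theorem exists_mem_of_pairwise_inter {ι : Type*} (I : Finset ι) (hI : I.Nonempty)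
    (S : ι → Finset V) (hS : ∀ i ∈ I, T.Preconnected (S i))
    (hne : ∀ i ∈ I, ∀ j ∈ I, (S i ∩ S j).Nonempty) : ∃ x, ∀ i ∈ I, x ∈ S i := by
  have htop : ∀ i, ∃ t, i ∈ I → T.IsTop (S i) t := fun i => by
    by_cases hi : i ∈ I
    · obtain ⟨t, ht⟩ := (hS i hi).exists_isTop ((hne i hi i hi).mono Finset.inter_subset_left)
      exact ⟨t, fun _ => ht⟩
    · obtain ⟨j, hj⟩ := hI
      exact ⟨(hne j hj j hj).choose, fun h => absurd h hi⟩
  choose t ht using htop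
  obtain ⟨i, hi, hmax⟩ := I.exists_max_image (fun i => T.depth (t i)) hI
  exact ⟨t i, fun j hj => (ht j hj).mem_of_depth_le (ht i hi) (hmax j hj) (hne j hj i hi)⟩

theorem Preconnected.biUnion {ι : Type*} (I : Finset ι)
    (S : ι → Finset V) (hS : ∀ i ∈ I, T.Preconnected (S i))
    (hne : ∀ i ∈ I, ∀ j ∈ I, (S i ∩ S j).Nonempty) : T.Preconnected (I.biUnion S) := by
  intro x hx y hy
  obtain ⟨i, hi, hxi⟩ := Finset.mem_biUnion.1 hx
  obtain ⟨j, hj, hyj⟩ := Finset.mem_biUnion.1 hy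
  obtain ⟨z, hz⟩ := hne i hi j hj
  rw [Finset.mem_inter] at hz
  exact ReflTransGen.trans
    (ReflTransGen.lift id (fun _ _ h => AdjIn.mono (Finset.subset_biUnion_of_mem S hi) h)
      _ _ (hS i hi x hxi z hz.1))
    (ReflTransGen.lift id (fun _ _ h => AdjIn.mono (Finset.subset_biUnion_of_mem S hj) h)
      _ _ (hS j hj z hz.2 y hyj))

theorem exists_preconnected_superset (P : Finset V) : ∃ S, P ⊆ S ∧ T.Preconnected S := by
  rcases P.eq_empty_or_nonempty with rfl | ⟨p, hp⟩
  · exact ⟨∅, by simp, by simp [Preconnected]⟩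
  have hdepth : ∀ i x, i ≤ T.depth x → T.depth (T.parent^[i] x) + i = T.depth x := by
    intro i
    induction i with
    | zero => simp
    | succ i ih =>
      intro x hi
      have h1 := ih x (by omega)
      rw [Function.iterate_succ_apply']
      have := T.depth_parent (T.parent^[i] x) (by omega)
      omega
  let S := P.biUnion fun x => (Finset.range (T.depth x + 1)).image fun i => T.parent^[i] x
  have hmem : ∀ y, y ∈ S ↔ ∃ x ∈ P, ∃ i ≤ T.depth x, T.parent^[i] x = y := by
    intro y
    simp [S]
  refine ⟨S, fun x hx => (hmem x).2 ⟨x, hx, 0, by simp⟩, ?_⟩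
  have hroot := hdepth _ p le_rfl
  refine IsTop.preconnected (t := T.parent^[T.depth p] p)
    ⟨(hmem _).2 ⟨p, hp, _, le_rfl, rfl⟩, fun y hy hne => ?_⟩
  have h0 : T.depth y ≠ 0 := fun h0 => hne (T.eq_of_depth_eq_zero _ _ h0 (by omega))
  refine ⟨by omega, ?_⟩
  obtain ⟨x, hx, i, hi, rfl⟩ := (hmem y).1 hy
  have := hdepth i x hi
  exact (hmem _).2 ⟨x, hx, i + 1, by omega, Function.iterate_succ_apply' _ _ _⟩

theorem Preconnected.card_edges {S : Finset V} (hS : T.Preconnected S) (hne : S.Nonempty) :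
    (T.edges S).card + 1 = S.card := by
  classical
  obtain ⟨t, ht⟩ := hS.exists_isTop hne
  rw [← Finset.card_erase_add_one ht.1]
  congr 1
  symm
  have h0 : ∀ x ∈ S.erase t, T.depth x ≠ 0 ∧ T.parent x ∈ S := fun x hx => by
    have := ht.2 x (Finset.mem_of_mem_erase hx) (Finset.ne_of_mem_erase hx)
    exact ⟨by omega, this.2⟩
  refine Finset.card_bij
    (fun x _ => if T.edge x (T.parent x) then (x, T.parent x) else (T.parent x, x)) ?_ ?_ ?_
  · intro x hx
    have hp := T.edge_parent x (h0 x hx).1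
    have hxS := Finset.mem_of_mem_erase hx
    split_ifs with h
    · exact mem_edges.2 ⟨hxS, (h0 x hx).2, h⟩
    · exact mem_edges.2 ⟨(h0 x hx).2, hxS, hp.resolve_left h⟩
  · intro x hx y hy h
    have h1 := T.depth_parent x (h0 x hx).1
    have h2 := T.depth_parent y (h0 y hy).1
    split_ifs at h <;> rw [Prod.mk.injEq] at h
    · exact h.1
    · rw [h.2] at h1
      rw [← h.1] at h2
      omega
    · rw [h.1] at h1
      rw [← h.2] at h2
      omega
    · exact h.2
  · rintro ⟨x, y⟩ hxy
    obtain ⟨hx, hy, he⟩ := mem_edges.1 hxy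
    have hte : ∀ z w, z ∈ S → w ∈ S → T.depth z ≠ 0 → T.parent z = w → z ∈ S.erase t := by
      intro z w hz hw hz0 hzw
      refine Finset.mem_erase.2 ⟨?_, hz⟩
      rintro rfl
      have := T.depth_parent z hz0
      rw [hzw] at this
      have := (ht.2 w hw (by rintro rfl; omega)).1
      omega
    rcases T.parent_of_edge x y he with ⟨hx0, hp⟩ | ⟨hy0, hp⟩
    · refine ⟨x, hte x y hx hy hx0 hp, ?_⟩
      dsimp only at he
      rw [hp, if_pos he]
    · refine ⟨y, hte y x hy hx hy0 hp, ?_⟩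
      dsimp only at he
      rw [hp, if_neg (T.edge_asymm _ _ he)]

end DecidableEq

end OrientedTree

/-- The rank of a point stabilizer in an action of a free group bounds the number of independent
cycles in any finite subgraph of the Schreier graph of its orbit. -/
theorem card_schreier_edges_lt {k r : ℕ} {Ω : Type*} [DecidableEq Ω]
    [MulAction (FreeGroup (Fin k)) Ω] (ω₀ : Ω)
    (e : MulAction.stabilizer (FreeGroup (Fin k)) ω₀ ≃* FreeGroup (Fin r))
    (W : Finset Ω) (hne : W.Nonempty) (hW : ∀ ω ∈ W, ∃ g : FreeGroup (Fin k), g • ω₀ = ω) :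
    ∑ i : Fin k, (W.filter fun ω => FreeGroup.of i • ω ∈ W).card < r + W.card := by
  classical
  let E : Finset (Fin k × Ω) := (Finset.univ ×ˢ W).filter fun p => FreeGroup.of p.1 • p.2 ∈ W
  have hEmem : ∀ i ω, (i, ω) ∈ E ↔ ω ∈ W ∧ FreeGroup.of i • ω ∈ W := by
    intro i ω; simp [E]
  have hEcard : E.card = ∑ i : Fin k, (W.filter fun ω => FreeGroup.of i • ω ∈ W).card := by
    simp only [E, Finset.card_filter, Finset.sum_product]
  -- the tautological cocycle
  let f : Fin k → Ω → (E → ℚ) := fun i ω p => if p.1 = (i, ω) then 1 else 0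
  let σ : Fin k → Equiv.Perm (Ω × (E → ℚ)) := fun i =>
    { toFun := fun p => (FreeGroup.of i • p.1, p.2 + f i p.1)
      invFun := fun p => ((FreeGroup.of i)⁻¹ • p.1, p.2 - f i ((FreeGroup.of i)⁻¹ • p.1))
      left_inv := fun p => by simp
      right_inv := fun p => by simp }
  let ρ : FreeGroup (Fin k) →* Equiv.Perm (Ω × (E → ℚ)) := FreeGroup.lift σ
  let c : FreeGroup (Fin k) → Ω → (E → ℚ) := fun g ω => (ρ g (ω, 0)).2
  have hρof : ∀ i ω m, ρ (FreeGroup.of i) (ω, m) = (FreeGroup.of i • ω, m + f i ω) := by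
    intro i ω m; simp [ρ, σ]
  have hρ : ∀ g : FreeGroup (Fin k), ∃ d : Ω → (E → ℚ), ∀ ω m, ρ g (ω, m) = (g • ω, m + d ω) := by
    intro g
    induction g using FreeGroup.induction_on with
    | C1 => exact ⟨0, by simp⟩
    | of i => exact ⟨f i, hρof i⟩
    | inv_of i ih =>
      refine ⟨fun ω => - f i ((FreeGroup.of i)⁻¹ • ω), fun ω m => ?_⟩
      rw [map_inv, Equiv.Perm.inv_eq_iff_eq, hρof]
      simp [add_assoc]
    | mul g g' ih ih' =>
      obtain ⟨d, hd⟩ := ih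
      obtain ⟨d', hd'⟩ := ih'
      refine ⟨fun ω => d' ω + d (g' • ω), fun ω m => ?_⟩
      rw [map_mul, Equiv.Perm.mul_apply, hd', hd, mul_smul, add_assoc]
  have hc : ∀ g ω m, ρ g (ω, m) = (g • ω, m + c g ω) := by
    intro g ω m
    obtain ⟨d, hd⟩ := hρ g
    simp only [c, hd, zero_add]
  have hcmul : ∀ g g' ω, c (g * g') ω = c g' ω + c g (g' • ω) := by
    intro g g' ω
    have : c (g * g') ω = (ρ (g * g') (ω, 0)).2 := rfl
    rw [this, map_mul, Equiv.Perm.mul_apply, hc, hc, zero_add]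
  have hcof : ∀ i ω, c (FreeGroup.of i) ω = f i ω := by
    intro i ω; simp only [c, hρof, zero_add]
  let T : (E → ℚ) →ₗ[ℚ] (Fin r → ℚ) :=
    Matrix.mulVecLin (Matrix.of fun j p => c (e.symm (FreeGroup.of j)) ω₀ p)
  let δ : (W → ℚ) →ₗ[ℚ] (E → ℚ) :=
    { toFun := fun u p => u ⟨FreeGroup.of p.1.1 • p.1.2, ((hEmem _ _).1 p.2).2⟩ -
        u ⟨p.1.2, ((hEmem _ _).1 p.2).1⟩
      map_add' := fun u v => by ext p; simp; ring
      map_smul' := fun a u => by ext p; simp; ring }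
  have hker : LinearMap.ker T ≤ LinearMap.range δ := by
    intro a ha
    have ha' : ∀ j, c (e.symm (FreeGroup.of j)) ω₀ ⬝ᵥ a = 0 := fun j =>
      congr_fun (LinearMap.mem_ker.1 ha) j
    let χ : MulAction.stabilizer (FreeGroup (Fin k)) ω₀ →* Multiplicative ℚ :=
      { toFun := fun g => Multiplicative.ofAdd (c g ω₀ ⬝ᵥ a)
        map_one' := by simp [c]
        map_mul' := fun g g' => by
          rw [Subgroup.coe_mul, hcmul, MulAction.mem_stabilizer_iff.1 g'.2, add_dotProduct,
            add_comm, ofAdd_add] }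
    have hχ : χ.comp e.symm.toMonoidHom = 1 := by
      ext j
      exact ha' j
    have hstab : ∀ g : FreeGroup (Fin k), g • ω₀ = ω₀ → c g ω₀ ⬝ᵥ a = 0 := by
      intro g hg
      have := DFunLike.congr_fun hχ (e ⟨g, hg⟩)
      simpa [χ] using this
    choose! γ hγ using hW
    refine ⟨fun ω => c (γ ω) ω₀ ⬝ᵥ a, ?_⟩
    funext ⟨⟨i, ω⟩, hp⟩
    obtain ⟨h1, h2⟩ := (hEmem i ω).1 hp
    have hs := hstab ((γ (FreeGroup.of i • ω))⁻¹ * (FreeGroup.of i * γ ω))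
      (by rw [mul_smul, mul_smul, hγ _ h1, inv_smul_eq_iff, hγ _ h2])
    have hcm := hcmul (γ (FreeGroup.of i • ω))
      ((γ (FreeGroup.of i • ω))⁻¹ * (FreeGroup.of i * γ ω)) ω₀
    rw [mul_inv_cancel_left, hcmul, hγ _ h1, hcof, mul_smul, mul_smul, hγ _ h1,
      inv_smul_eq_iff.2 (hγ _ h2).symm] at hcm
    have hdot := congr_arg (· ⬝ᵥ a) hcm
    simp only [add_dotProduct, hs, zero_add] at hdot
    have hf : f i ω ⬝ᵥ a = a ⟨(i, ω), hp⟩ := by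
      have : f i ω = Pi.single ⟨(i, ω), hp⟩ 1 := by
        ext p
        simp [f, Pi.single_apply, Subtype.ext_iff]
      rw [this, single_one_dotProduct]
    rw [hf] at hdot
    change c (γ (FreeGroup.of i • ω)) ω₀ ⬝ᵥ a - c (γ ω) ω₀ ⬝ᵥ a = _
    rw [← hdot]
    ring
  have hT := LinearMap.finrank_range_add_finrank_ker T
  have hδ := LinearMap.finrank_range_add_finrank_ker δ
  have h1 := Submodule.finrank_mono hker
  have h2 := Submodule.finrank_le (LinearMap.range T)
  have h3 : 0 < Module.finrank ℚ (LinearMap.ker δ) := by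
    rw [Module.finrank_pos_iff_exists_ne_zero]
    refine ⟨⟨fun _ => 1, by ext p; simp [δ]⟩, fun h => ?_⟩
    obtain ⟨w, hw⟩ := hne
    have := congr_fun (congr_arg Subtype.val h) ⟨w, hw⟩
    simp at this
  simp only [Module.finrank_fintype_fun_eq_card, Fintype.card_coe, Fintype.card_fin] at hT hδ h2
  omega

namespace FreeGroup

theorem IsReduced.exists_isSuffix_length {α : Type*} [Nonempty α] {L : ℕ} {u : List (α × Bool)}
    (hu : IsReduced u) (hL : u.length ≤ L) :
    ∃ u', IsReduced u' ∧ u'.length = L ∧ u <:+ u' := by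
  induction L, hL using Nat.le_induction with
  | base => exact ⟨u, hu, rfl, List.suffix_rfl⟩
  | succ n _ ih =>
    obtain ⟨u', hr, hl, hs⟩ := ih
    cases u' with
    | nil =>
      refine ⟨[(Classical.arbitrary α, true)], List.isChain_singleton _, by simp [← hl], ?_⟩
      exact hs.trans (List.nil_suffix)
    | cons a t =>
      refine ⟨a :: a :: t, List.isChain_cons_cons.2 ⟨fun _ => rfl, hr⟩, by simpa using hl, ?_⟩
      exact hs.trans (List.suffix_cons _ _)

/-- The finite set of points visited by the periodic orbit of a base point along the letters of a
cyclically reduced word `h` fixing the base point and containing all reduced words of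
length `L`. -/
theorem exists_finset_of_forall_infix {k L : ℕ} (hk : 2 ≤ k) (hL : 2 ≤ L)
    {h : FreeGroup (Fin k)} (hcyc : IsReduced (toWord h ++ toWord h))
    (hall : ∀ u : List (Fin k × Bool), reduce u = u → u.length = L → u <:+: toWord h)
    {V : Type*} [DecidableEq V] [MulAction (FreeGroup (Fin k)) V] (v₀ : V) (hv : h • v₀ = v₀) :
    ∃ P : Finset V,
      (∀ p ∈ P, ∃ s s' : Fin k × Bool, s ≠ s' ∧ (mk [s])⁻¹ • p ∈ P ∧ (mk [s'])⁻¹ • p ∈ P) ∧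
      (∀ g : FreeGroup (Fin k), g.norm ≤ L → ∃ p ∈ P, g • p ∈ P) ∧
      ∀ s s' : Fin k × Bool, s ≠ s' → ∃ p ∈ P, (mk [s])⁻¹ • p ∈ P ∧ (mk [s'])⁻¹ • p ∈ P := by
  have : Nonempty (Fin k) := ⟨⟨0, by omega⟩⟩
  set w := toWord h with hw
  let x : ℕ → V := fun j => mk ((w ++ w).drop j) • v₀
  let P : Finset V := (Finset.range (2 * w.length + 1)).image x
  have hmem : ∀ j ≤ 2 * w.length, x j ∈ P := fun j hj =>
    Finset.mem_image_of_mem _ (Finset.mem_range.2 (by omega))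
  have hsuff : ∀ u : List (Fin k × Bool), IsReduced u → u.length ≤ L →
      ∃ p, ∀ v, v <:+ u → mk v • p ∈ P := by
    intro u hu hlen
    obtain ⟨u', hr, hl, hs⟩ := hu.exists_isSuffix_length hlen
    obtain ⟨a, b, hab⟩ := hall u' hr.reduce_eq hl
    refine ⟨mk (b ++ w) • v₀, fun v hv => ?_⟩
    obtain ⟨c, hc⟩ := hv.trans hs
    have := hmem (a ++ c).length (by rw [← hab, ← hc]; simp; omega)
    convert this using 1
    simp only [x]
    rw [← mul_smul, mul_mk]
    congr 2
    have : w ++ w = (a ++ c) ++ (v ++ (b ++ w)) := by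
      conv_lhs => rw [← hab, ← hc]
      simp
      simp [← hab, ← hc]
    rw [this, List.drop_left]
  have hq : 0 < w.length := by
    obtain ⟨u', hr, hl, -⟩ := (IsReduced.nil (α := Fin k)).exists_isSuffix_length (L := L) (by simp)
    have := (hall u' hr.reduce_eq hl).length_le
    omega
  have hper : ∀ j ≤ w.length, x (w.length + j) = x j := by
    intro j hj
    simp only [x]
    rw [List.drop_append_of_le_length hj, ← List.drop_drop, List.drop_left, ← mul_mk, mul_smul,
      hw, mk_toWord, hv]
  have hstep : ∀ j (hj : j < (w ++ w).length), x j = mk [(w ++ w)[j]] • x (j + 1) := by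
    intro j hj
    simp only [x]
    rw [List.drop_eq_getElem_cons hj, ← mul_smul, mul_mk]
    rfl
  refine ⟨P, ?_, ?_, ?_⟩
  · intro p hp
    obtain ⟨j, hj1, rfl⟩ : ∃ j, j + 1 < (w ++ w).length ∧ x (j + 1) = p := by
      obtain ⟨j, hj, rfl⟩ := Finset.mem_image.1 hp
      rw [Finset.mem_range] at hj
      simp only [List.length_append]
      rcases Nat.eq_zero_or_pos j with rfl | h0
      · refine ⟨w.length - 1, by omega, ?_⟩
        rw [← hper 0 (by omega)]; congr 1; omega
      · by_cases h1 : j = 2 * w.length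
        · refine ⟨w.length - 1, by omega, ?_⟩
          rw [h1, two_mul, hper _ le_rfl]; congr 1; omega
        · exact ⟨j - 1, by omega, by congr 1; omega⟩
    have hlen : (w ++ w).length = 2 * w.length := by simp [two_mul]
    refine ⟨(w ++ w)[j + 1], ((w ++ w)[j].1, !(w ++ w)[j].2), ?_, ?_, ?_⟩
    · intro heq
      have := List.isChain_iff_getElem.1 hcyc j hj1
      rw [heq] at this
      simpa using this rfl
    · rw [hstep (j + 1) hj1, inv_smul_smul]
      exact hmem _ (by omega)
    · have h1 := hstep j (by omega)
      have h2 : (mk [((w ++ w)[j].1, !(w ++ w)[j].2)])⁻¹ = mk [(w ++ w)[j]] := by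
        simp [inv_mk, invRev]
      rw [h2, ← h1]
      exact hmem _ (by omega)
  · intro g hg
    obtain ⟨p, hp⟩ := hsuff g.toWord isReduced_toWord hg
    refine ⟨p, ?_, ?_⟩
    · simpa [← one_eq_mk] using hp [] (List.nil_suffix)
    · simpa [mk_toWord] using hp _ List.suffix_rfl
  · rintro ⟨a, b⟩ ⟨a', b'⟩ hne
    obtain ⟨p, hp⟩ := hsuff [(a, !b), (a', b')] (by
      refine List.isChain_cons_cons.2 ⟨fun h1 => ?_, List.isChain_singleton _⟩
      simp only at h1 ⊢
      subst h1
      cases b <;> cases b' <;> simp_all) hL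
    refine ⟨mk [(a', b')] • p, hp _ (List.suffix_cons _ _), ?_, ?_⟩
    · simpa [inv_mk, invRev, ← mul_smul, mul_mk] using hp _ List.suffix_rfl
    · rw [inv_smul_smul]
      simpa [← one_eq_mk] using hp [] (List.nil_suffix)

end FreeGroup

namespace OrientedTree

open scoped Pointwise

variable {V : Type*} [DecidableEq V] {T : OrientedTree V}

theorem Preconnected.smul {G : Type*} [Group G] [MulAction G V]
    (hinv : ∀ (g : G) x y, T.edge x y → T.edge (g • x) (g • y)) {S : Finset V}
    (hS : T.Preconnected S) (g : G) : T.Preconnected (g • S) := by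
  intro x hx y hy
  obtain ⟨x, hxS, rfl⟩ := Finset.mem_smul_finset.1 hx
  obtain ⟨y, hyS, rfl⟩ := Finset.mem_smul_finset.1 hy
  refine Relation.ReflTransGen.lift (fun z => g • z) (fun a b hab => ?_) _ _ (hS x hxS y hyS)
  exact ⟨Finset.smul_mem_smul_finset hab.1, Finset.smul_mem_smul_finset hab.2.1,
    hab.2.2.imp (hinv g _ _) (hinv g _ _)⟩

theorem exists_preconnected_two_le_card {k : ℕ} [NeZero k] [MulAction (FreeGroup (Fin k)) V]
    (hinv : ∀ (g : FreeGroup (Fin k)) x y, T.edge x y → T.edge (g • x) (g • y))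
    {P : Finset V}
    (hP : ∀ p ∈ P, ∃ s s' : Fin k × Bool, s ≠ s' ∧
      (FreeGroup.mk [s])⁻¹ • p ∈ P ∧ (FreeGroup.mk [s'])⁻¹ • p ∈ P)
    (hmeet : ∀ s : Fin k × Bool, ∃ p ∈ P, FreeGroup.mk [s] • p ∈ P)
    (hmeet₂ : ∀ s s' : Fin k × Bool, s ≠ s' → ∃ p ∈ P,
      (FreeGroup.mk [s])⁻¹ • p ∈ P ∧ (FreeGroup.mk [s'])⁻¹ • p ∈ P) :
    ∃ S, P ⊆ S ∧ T.Preconnected S ∧ ∀ p ∈ S,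
      2 ≤ (Finset.univ.filter fun s : Fin k × Bool => p ∈ FreeGroup.mk [s] • S).card := by
  obtain ⟨S, ⟨hPS, hS⟩, hmin⟩ := (measure (Finset.card (α := V))).wf.has_min
    {S | P ⊆ S ∧ T.Preconnected S} (exists_preconnected_superset P)
  refine ⟨S, hPS, hS, fun p hp => ?_⟩
  by_contra! hlt
  have hone : ∃ s₀, ∀ s : Fin k × Bool, s ≠ s₀ → p ∉ FreeGroup.mk [s] • S := by
    by_cases h : ∃ s₀ : Fin k × Bool, p ∈ FreeGroup.mk [s₀] • S
    · obtain ⟨s₀, h₀⟩ := h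
      refine ⟨s₀, fun s hs hps => hs ?_⟩
      exact Finset.card_le_one.1 (Nat.le_of_lt_succ hlt) s (by simpa using hps) s₀
        (by simpa using h₀)
    · push Not at h
      exact ⟨(0, true), fun s _ => h s⟩
  obtain ⟨s₀, hs₀⟩ := hone
  refine hmin ((Finset.univ.erase s₀).biUnion fun s => FreeGroup.mk [s] • S ∩ S) ⟨?_, ?_⟩ ?_
  · intro x hx
    obtain ⟨s, s', hne, h1, h2⟩ := hP x hx
    have key : ∃ s ≠ s₀, (FreeGroup.mk [s])⁻¹ • x ∈ P := by
      by_cases h : s = s₀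
      · exact ⟨s', fun h' => hne (h.trans h'.symm), h2⟩
      · exact ⟨s, h, h1⟩
    obtain ⟨s, hs, hx'⟩ := key
    exact Finset.mem_biUnion.2 ⟨s, by simpa using hs, Finset.mem_inter.2
      ⟨Finset.inv_smul_mem_iff.1 (hPS hx'), hPS hx⟩⟩
  · refine Preconnected.biUnion _ _ (fun s _ => (hS.smul hinv _).inter hS) fun s _ s' _ => ?_
    by_cases h : s = s'
    · subst h
      obtain ⟨x, hx, hx'⟩ := hmeet s
      refine ⟨FreeGroup.mk [s] • x, ?_⟩
      simp [hPS hx, hPS hx']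
    · obtain ⟨x, hx, h1, h2⟩ := hmeet₂ s s' h
      refine ⟨x, ?_⟩
      simp only [Finset.mem_inter, ← Finset.inv_smul_mem_iff]
      exact ⟨⟨hPS h1, hPS hx⟩, hPS h2, hPS hx⟩
  · refine Finset.card_lt_card ⟨?_, fun hsub => ?_⟩
    · exact Finset.biUnion_subset.2 fun s _ => Finset.inter_subset_right
    · obtain ⟨s, hs, hps⟩ := Finset.mem_biUnion.1 (hsub hp)
      exact hs₀ s (by simpa using hs) (Finset.mem_inter.1 hps).1

theorem Preconnected.exists_common_subset {k L : ℕ} (hL : 2 ≤ L) [MulAction (FreeGroup (Fin k)) V]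
    (hinv : ∀ (g : FreeGroup (Fin k)) x y, T.edge x y → T.edge (g • x) (g • y))
    {S : Finset V} (hS : T.Preconnected S)
    (hmeet : ∀ g : FreeGroup (Fin k), g.norm ≤ L → ∃ p ∈ S, g • p ∈ S)
    (i₀ : Fin k) (hfree : ∀ n : ℕ, 0 < n → ∀ x : V, FreeGroup.of i₀ ^ n • x ≠ x) :
    ∃ Y ⊆ S, Y.card = L - 1 ∧ ∀ y ∈ Y, ∀ s : Fin k × Bool, y ∈ FreeGroup.mk [s] • S := by
  let a : Option (Fin k × Bool) → FreeGroup (Fin k) := fun o => o.elim 1 fun s => FreeGroup.mk [s]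
  have ha : ∀ o, (a o).norm ≤ 1 := by
    rintro (_ | s)
    · simp [a]
    · exact FreeGroup.norm_mk_le
  obtain ⟨x, hx⟩ := exists_mem_of_pairwise_inter (T := T)
    (Finset.range (L - 1) ×ˢ (Finset.univ : Finset (Option (Fin k × Bool))))
    ⟨(0, none), by simp; omega⟩
    (fun p => (FreeGroup.of i₀ ^ p.1 * a p.2) • S) (fun p _ => hS.smul hinv _) (by
      rintro ⟨i, o⟩ hi ⟨j, o'⟩ hj
      simp only [Finset.mem_product, Finset.mem_range, Finset.mem_univ, and_true] at hi hj
      have hpow : ((FreeGroup.of i₀ ^ i)⁻¹ * FreeGroup.of i₀ ^ j).norm ≤ L - 2 := by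
        rcases le_total i j with hij | hij
        · obtain ⟨d, rfl⟩ := Nat.exists_eq_add_of_le hij
          rw [pow_add, inv_mul_cancel_left, FreeGroup.norm_of_pow]
          omega
        · obtain ⟨d, rfl⟩ := Nat.exists_eq_add_of_le hij
          rw [pow_add, mul_inv_rev, mul_assoc, inv_mul_cancel, mul_one,
            FreeGroup.norm_inv_eq, FreeGroup.norm_of_pow]
          omega
      obtain ⟨p, hp, hp'⟩ := hmeet
        ((a o)⁻¹ * ((FreeGroup.of i₀ ^ i)⁻¹ * FreeGroup.of i₀ ^ j) * a o') (by
          have h1 := FreeGroup.norm_mul_le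
            ((a o)⁻¹ * ((FreeGroup.of i₀ ^ i)⁻¹ * FreeGroup.of i₀ ^ j)) (a o')
          have h2 := FreeGroup.norm_mul_le (a o)⁻¹
            ((FreeGroup.of i₀ ^ i)⁻¹ * FreeGroup.of i₀ ^ j)
          have h3 := ha o
          have h4 := ha o'
          rw [FreeGroup.norm_inv_eq] at h2
          omega)
      refine ⟨(FreeGroup.of i₀ ^ j * a o') • p, Finset.mem_inter.2
        ⟨Finset.inv_smul_mem_iff.1 ?_, Finset.smul_mem_smul_finset hp⟩⟩
      rw [← mul_smul]
      convert hp' using 2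
      group)
  have hmem : ∀ i < L - 1, ∀ o, (FreeGroup.of i₀ ^ i)⁻¹ • x ∈ a o • S := by
    intro i hi o
    have := hx (i, o) (by simpa using hi)
    rwa [mul_smul, ← Finset.inv_smul_mem_iff] at this
  refine ⟨(Finset.range (L - 1)).image fun i => (FreeGroup.of i₀ ^ i)⁻¹ • x, ?_, ?_, ?_⟩
  · intro y hy
    obtain ⟨i, hi, rfl⟩ := Finset.mem_image.1 hy
    simpa [a] using hmem i (Finset.mem_range.1 hi) none
  · rw [Finset.card_image_of_injective, Finset.card_range]
    have key : ∀ i d, (FreeGroup.of i₀ ^ i)⁻¹ • x = (FreeGroup.of i₀ ^ (i + d))⁻¹ • x →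
        d = 0 := by
      intro i d hid
      by_contra hd
      refine hfree d (Nat.pos_of_ne_zero hd) ((FreeGroup.of i₀ ^ (i + d))⁻¹ • x) ?_
      rw [← mul_smul, ← hid]
      congr 1
      rw [add_comm, pow_add]
      group
    intro i j hij
    rcases le_total i j with h | h
    · obtain ⟨d, rfl⟩ := Nat.exists_eq_add_of_le h
      rw [key _ _ hij, add_zero]
    · obtain ⟨d, rfl⟩ := Nat.exists_eq_add_of_le h
      rw [key _ _ hij.symm, add_zero]
  · intro y hy s
    obtain ⟨i, hi, rfl⟩ := Finset.mem_image.1 hy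
    exact hmem i (Finset.mem_range.1 hi) (some s)

/-- A lower bound for the rank of free edge stabilizers of an edge-transitive action of a free
group on a tree, given a large finite configuration of vertices. -/
theorem mul_lt_of_edge_transitive {k L r : ℕ} (hk : 2 ≤ k) (hL : 2 ≤ L)
    [MulAction (FreeGroup (Fin k)) V]
    (hinv : ∀ (g : FreeGroup (Fin k)) x y, T.edge x y → T.edge (g • x) (g • y))
    (e₀ : V × V) (htrans : ∀ x y, T.edge x y → ∃ g : FreeGroup (Fin k), g • e₀ = (x, y))
    (e : MulAction.stabilizer (FreeGroup (Fin k)) e₀ ≃* FreeGroup (Fin r))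
    (i₀ : Fin k) (hfree : ∀ n : ℕ, 0 < n → ∀ x : V, FreeGroup.of i₀ ^ n • x ≠ x)
    {P : Finset V}
    (hP : ∀ p ∈ P, ∃ s s' : Fin k × Bool, s ≠ s' ∧
      (FreeGroup.mk [s])⁻¹ • p ∈ P ∧ (FreeGroup.mk [s'])⁻¹ • p ∈ P)
    (hmeet : ∀ g : FreeGroup (Fin k), g.norm ≤ L → ∃ p ∈ P, g • p ∈ P)
    (hmeet₂ : ∀ s s' : Fin k × Bool, s ≠ s' → ∃ p ∈ P,
      (FreeGroup.mk [s])⁻¹ • p ∈ P ∧ (FreeGroup.mk [s'])⁻¹ • p ∈ P) :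
    (k - 1) * (L - 2) < r := by
  have : NeZero k := ⟨by omega⟩
  obtain ⟨S, hPS, hS, hdeg⟩ := exists_preconnected_two_le_card hinv hP
    (fun s => hmeet _ (FreeGroup.norm_mk_le.trans (by simp; omega))) hmeet₂
  have hmeetS : ∀ g : FreeGroup (Fin k), g.norm ≤ L → ∃ p ∈ S, g • p ∈ S := fun g hg =>
    let ⟨p, hp, hp'⟩ := hmeet g hg
    ⟨p, hPS hp, hPS hp'⟩
  obtain ⟨Y, hYS, hYcard, hY⟩ := hS.exists_common_subset hL hinv hmeetS i₀ hfree
  have hcard2 : 1 < S.card := by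
    obtain ⟨p, hp, hp'⟩ := hmeetS (FreeGroup.of i₀) (by simp; omega)
    exact Finset.one_lt_card.2 ⟨_, hp', _, hp, by simpa using hfree 1 one_pos p⟩
  have hinv' : ∀ (g : FreeGroup (Fin k)) x y, T.edge (g • x) (g • y) ↔ T.edge x y := fun g x y =>
    ⟨fun h => by simpa using hinv g⁻¹ _ _ h, hinv g x y⟩
  have hcardS := hS.card_edges (Finset.card_pos.1 (by omega))
  have hcount := card_schreier_edges_lt e₀ e (T.edges S) (Finset.card_pos.1 (by omega))
    (fun p hp => htrans _ _ (mem_edges.1 hp).2.2)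
  have hfilter : ∀ i : Fin k,
      ((T.edges S).filter fun p => FreeGroup.of i • p ∈ T.edges S).card + 1 =
        (S ∩ (FreeGroup.of i)⁻¹ • S).card := by
    intro i
    rw [← (hS.inter (hS.smul hinv _)).card_edges]
    · congr 2
      ext ⟨x, y⟩
      simp only [Finset.mem_filter, mem_edges, Prod.smul_mk, hinv', Finset.mem_inter,
        ← Finset.inv_smul_mem_iff, inv_inv]
      tauto
    · obtain ⟨p, hp, hp'⟩ := hmeetS (FreeGroup.of i) (by simp; omega)
      exact ⟨p, Finset.mem_inter.2 ⟨hp, Finset.inv_smul_mem_iff.1 (by simpa using hp')⟩⟩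
  have hsum : ∑ p ∈ S, (Finset.univ.filter fun s : Fin k × Bool =>
      p ∈ FreeGroup.mk [s] • S).card = 2 * ∑ i : Fin k, (S ∩ (FreeGroup.of i)⁻¹ • S).card := by
    have h1 := Finset.sum_card_bipartiteAbove_eq_sum_card_bipartiteBelow (s := S)
      (t := (Finset.univ : Finset (Fin k × Bool))) (fun p s => p ∈ FreeGroup.mk [s] • S)
    simp only [Finset.bipartiteAbove, Finset.bipartiteBelow] at h1
    rw [h1, Fintype.sum_prod_type, Finset.mul_sum]
    refine Finset.sum_congr rfl fun i _ => ?_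
    rw [Fintype.sum_bool, two_mul, Finset.filter_mem_eq_inter, Finset.filter_mem_eq_inter]
    refine congrArg₂ _ (Eq.symm ?_) rfl
    rw [← Finset.card_smul_finset (FreeGroup.of i) (S ∩ _), Finset.smul_finset_inter,
      smul_inv_smul, Finset.inter_comm]
    rfl
  have hlow : ∑ p ∈ S, (2 + if p ∈ Y then 2 * k - 2 else 0) ≤
      ∑ p ∈ S, (Finset.univ.filter fun s : Fin k × Bool => p ∈ FreeGroup.mk [s] • S).card := by
    refine Finset.sum_le_sum fun p hp => ?_
    split_ifs with hpY
    · rw [Finset.filter_true_of_mem fun s _ => hY p hpY s]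
      simp
      omega
    · simpa using hdeg p hp
  rw [hsum, Finset.sum_add_distrib, Finset.sum_const, Finset.sum_ite_mem,
    Finset.inter_eq_right.2 hYS, Finset.sum_const, hYcard] at hlow
  have hsum' : ∑ i : Fin k, (S ∩ (FreeGroup.of i)⁻¹ • S).card =
      ∑ i : Fin k, ((T.edges S).filter fun p => FreeGroup.of i • p ∈ T.edges S).card + k := by
    rw [← Finset.sum_congr rfl fun i _ => hfilter i, Finset.sum_add_distrib]
    simp
  obtain ⟨k, rfl⟩ := Nat.exists_eq_add_of_le hk
  obtain ⟨L, rfl⟩ := Nat.exists_eq_add_of_le hL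
  rw [hsum'] at hlow
  have e1 : 2 + k - 1 = k + 1 := by omega
  have e2 : 2 + L - 2 = L := by omega
  have e3 : 2 + L - 1 = L + 1 := by omega
  have e4 : 2 * (2 + k) - 2 = 2 * (k + 1) := by omega
  rw [e3, e4] at hlow
  rw [e1, e2]
  simp only [smul_eq_mul] at hlow
  nlinarith

end OrientedTree

namespace HNNExtension

open NormalWord

variable {A : Type*} [Group A] {C C' : Subgroup A}

namespace NormalWord

variable {d : TransversalPair A C C'}

/-- The normal word obtained by removing the head and the first stable letter. -/
def tail (w : NormalWord d) : NormalWord d :=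
  consRecOn (motive := fun _ => NormalWord d) w ofGroup fun _ _ w' _ _ _ => w'

theorem tail_cons (g : A) (u : ℤˣ) (w : NormalWord d) (h1 : w.head ∈ d.set u)
    (h2 : ∀ u' ∈ Option.map Prod.fst w.toList.head?, w.head ∈ toSubgroup C C' u → u = u') :
    (cons g u w h1 h2).tail = w :=
  rfl

theorem tail_toList (w : NormalWord d) : w.tail.toList = w.toList.tail := by
  cases w using consRecOn with
  | ofGroup g => rfl
  | cons g u w h1 h2 => rfl

theorem eq_group_smul_of_toList_eq {w w' : NormalWord d} (h : w.toList = w'.toList) :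
    w' = (w'.head * w.head⁻¹) • w := by
  ext1
  · simp
  · simp [h]

theorem unitsSMul_tail (ψ : C ≃* C') (u : ℤˣ) (w : NormalWord d) :
    ((unitsSMul ψ u w).toList ≠ [] ∧ (unitsSMul ψ u w).toList.tail = w.toList) ∨
      (w.toList ≠ [] ∧ w.toList.tail = (unitsSMul ψ u w).toList) := by
  by_cases h : Cancels u w
  · right
    rw [unitsSMul, dif_pos h]
    cases w using consRecOn with
    | ofGroup g => simp [Cancels] at h
    | cons g u w h1 h2 => simp [unitsSMulWithCancel]
  · left
    rw [unitsSMul, dif_neg h]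
    simp

end NormalWord

variable (ψ : C ≃* C')

/-- The homomorphism counting the exponent of the stable letter. -/
noncomputable def exponent : HNNExtension A C C' ψ →* Multiplicative ℤ :=
  lift 1 (Multiplicative.ofAdd 1) (by simp)

@[simp]
theorem exponent_of (a : A) : exponent ψ (of a) = 1 := by
  simp [exponent]

@[simp]
theorem exponent_t : exponent ψ t = Multiplicative.ofAdd 1 := by
  simp [exponent]

/-- The vertices of the Bass-Serre tree of an HNN extension. -/
abbrev TreeVertex : Type _ :=
  HNNExtension A C C' ψ ⧸ (of : A →* HNNExtension A C C' ψ).range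

/-- The base edge of the Bass-Serre tree of an HNN extension. -/
def treeEdge : TreeVertex ψ × TreeVertex ψ :=
  ((1 : HNNExtension A C C' ψ), (t⁻¹ : HNNExtension A C C' ψ))

theorem exists_out_eq_mul_of (g : HNNExtension A C C' ψ) :
    ∃ a : A, (g : TreeVertex ψ).out = g * of a := by
  obtain ⟨⟨_, a, rfl⟩, h⟩ := QuotientGroup.mk_out_eq_mul (of : A →* HNNExtension A C C' ψ).range g
  exact ⟨a, h⟩

theorem exponent_mk_out (g : HNNExtension A C C' ψ) :
    exponent ψ (g : TreeVertex ψ).out = exponent ψ g := by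
  obtain ⟨a, h⟩ := exists_out_eq_mul_of ψ g
  simp [h]

theorem exponent_eq_one_of_smul_eq {g : HNNExtension A C C' ψ} {x : TreeVertex ψ}
    (h : g • x = x) : exponent ψ g = 1 := by
  obtain ⟨y, rfl⟩ := QuotientGroup.mk_surjective x
  have := congrArg (fun z : TreeVertex ψ => exponent ψ z.out) h
  rw [MulAction.Quotient.smul_mk] at this
  simpa [exponent_mk_out] using this

theorem stabilizer_treeEdge :
    MulAction.stabilizer (HNNExtension A C C' ψ) (treeEdge ψ) = C.map of := by
  ext g
  simp only [MulAction.mem_stabilizer_iff, treeEdge, Prod.smul_mk, Prod.mk.injEq,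
    MulAction.Quotient.smul_mk, smul_eq_mul, mul_one, QuotientGroup.eq, Subgroup.mem_map]
  constructor
  · rintro ⟨h1, h2⟩
    obtain ⟨a, rfl⟩ : g ∈ (of : A →* HNNExtension A C C' ψ).range := by simpa using h1
    refine ⟨a, ?_, rfl⟩
    by_contra ha
    let w : ReducedWord A C C' := ⟨1, [(1, a⁻¹), (-1, 1)], by simpa using ha⟩
    have := ReducedWord.toList_eq_nil_of_mem_of_range ψ w (by
      simpa [ReducedWord.prod, w, mul_assoc] using h2)
    simp [w] at this
  · rintro ⟨a, ha, rfl⟩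
    refine ⟨by simp, ψ ⟨a, ha⟩⁻¹, ?_⟩
    have := t_mul_of (φ := ψ) ⟨a, ha⟩⁻¹
    simp only [Subgroup.coe_inv, map_inv] at this ⊢
    rw [mul_inv_rev, inv_inv, this]
    simp

/-- The vertex of the Bass-Serre tree represented by the inverse of a normal word. -/
def treeVertex {d : TransversalPair A C C'} (w : NormalWord d) : TreeVertex ψ :=
  ((w.prod ψ)⁻¹ : HNNExtension A C C' ψ)

section

variable {ψ} {d : TransversalPair A C C'}

theorem treeVertex_eq_of_toList_eq {w w' : NormalWord d} (h : w.toList = w'.toList) :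
    treeVertex ψ w = treeVertex ψ w' := by
  rw [eq_group_smul_of_toList_eq h, treeVertex, treeVertex, prod_group_smul, QuotientGroup.eq]
  exact ⟨w.head * w'.head⁻¹, by simp [mul_assoc]⟩

theorem treeVertex_smul_empty (g : HNNExtension A C C' ψ) :
    treeVertex ψ (g⁻¹ • (empty : NormalWord d)) = g := by
  simp [treeVertex]

variable (d) in
/-- A normal word representing a vertex of the Bass-Serre tree. -/
noncomputable def vertexWord (x : TreeVertex ψ) : NormalWord d :=
  x.out⁻¹ • empty

theorem treeVertex_vertexWord (x : TreeVertex ψ) : treeVertex ψ (vertexWord d x) = x := by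
  rw [vertexWord, treeVertex_smul_empty]
  exact Quotient.out_eq _

theorem vertexWord_treeVertex_toList (w : NormalWord d) :
    (vertexWord d (treeVertex ψ w)).toList = w.toList := by
  obtain ⟨a, h⟩ := exists_out_eq_mul_of ψ (w.prod ψ)⁻¹
  rw [vertexWord, treeVertex, h, mul_inv_rev, inv_inv, mul_smul, prod_smul_empty, ← map_inv,
    of_smul_eq_smul, group_smul_toList]

theorem mem_orbit_treeEdge_iff (x y : TreeVertex ψ) :
    (∃ g : HNNExtension A C C' ψ, g • treeEdge ψ = (x, y)) ↔
      ∃ w : NormalWord d, x = treeVertex ψ w ∧ y = treeVertex ψ (unitsSMul ψ 1 w) := by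
  simp only [treeEdge, Prod.smul_mk, Prod.mk.injEq, MulAction.Quotient.smul_mk, smul_eq_mul,
    mul_one]
  constructor
  · rintro ⟨g, rfl, rfl⟩
    refine ⟨g⁻¹ • empty, (treeVertex_smul_empty g).symm, ?_⟩
    rw [← t_smul_eq_unitsSMul, ← mul_smul, ← treeVertex_smul_empty (d := d) (g * t⁻¹)]
    simp
  · rintro ⟨w, rfl, rfl⟩
    refine ⟨(w.prod ψ)⁻¹, rfl, ?_⟩
    rw [treeVertex, prod_unitsSMul]
    simp

end

variable (d : TransversalPair A C C')

/-- The Bass-Serre tree of an HNN extension. -/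
noncomputable def bassSerreTree : OrientedTree (TreeVertex ψ) where
  edge x y := ∃ g : HNNExtension A C C' ψ, g • treeEdge ψ = (x, y)
  parent x := treeVertex ψ (vertexWord d x).tail
  depth x := (vertexWord d x).toList.length
  eq_of_depth_eq_zero x y hx hy := by
    rw [← treeVertex_vertexWord (d := d) x, ← treeVertex_vertexWord (d := d) y]
    rw [List.length_eq_zero_iff] at hx hy
    exact treeVertex_eq_of_toList_eq (hx.trans hy.symm)
  depth_parent x hx := by
    rw [vertexWord_treeVertex_toList, tail_toList, List.length_tail]
    omega
  edge_parent x hx := by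
    simp only [mem_orbit_treeEdge_iff (d := d)]
    rw [← treeVertex_vertexWord (d := d) x]
    generalize vertexWord d x = w at *
    have htail : treeVertex ψ (vertexWord d (treeVertex ψ w)).tail = treeVertex ψ w.tail :=
      treeVertex_eq_of_toList_eq (by
        rw [tail_toList, tail_toList, vertexWord_treeVertex_toList])
    rw [htail]
    cases w using consRecOn with
    | ofGroup g => simp at hx
    | cons g u w h1 h2 =>
      rw [tail_cons]
      have hcons : treeVertex ψ (cons g u w h1 h2) = treeVertex ψ (unitsSMul ψ u w) := by
        have : cons g u w h1 h2 = g • unitsSMul ψ u w := by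
          apply prod_injective ψ d
          simp only [prod_cons, prod_group_smul, prod_unitsSMul]
        rw [this]
        exact treeVertex_eq_of_toList_eq (by simp)
      rw [hcons]
      rcases Int.units_eq_one_or u with rfl | rfl
      · exact .inr ⟨w, rfl, rfl⟩
      · refine .inl ⟨unitsSMul ψ (-1) w, rfl, ?_⟩
        have := unitsSMul_neg ψ (-1) w
        rw [neg_neg] at this
        rw [this]
  parent_of_edge x y h := by
    obtain ⟨w, rfl, rfl⟩ := (mem_orbit_treeEdge_iff (d := d) x y).1 h
    simp only [vertexWord_treeVertex_toList, ne_eq, List.length_eq_zero_iff]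
    refine (unitsSMul_tail ψ 1 w).symm.imp (And.imp id fun h => ?_) (And.imp id fun h => ?_) <;>
    · refine treeVertex_eq_of_toList_eq ?_
      rw [tail_toList, vertexWord_treeVertex_toList, h]
  edge_asymm x y := by
    have key : ∀ x y : TreeVertex ψ, (∃ g : HNNExtension A C C' ψ, g • treeEdge ψ = (x, y)) →
        exponent ψ x.out = exponent ψ y.out * Multiplicative.ofAdd 1 := by
      rintro x y ⟨g, h⟩
      simp only [treeEdge, Prod.smul_mk, Prod.mk.injEq, MulAction.Quotient.smul_mk, smul_eq_mul,
        mul_one] at h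
      obtain ⟨rfl, rfl⟩ := h
      simp [exponent_mk_out]
    intro h h'
    have h1 := congrArg Multiplicative.toAdd (key _ _ h)
    have h2 := congrArg Multiplicative.toAdd (key _ _ h')
    simp only [toAdd_mul, toAdd_ofAdd] at h1 h2
    omega

end HNNExtension

/-- Let `k ≥ 2`, `L ≥ 2`, and let `h ∈ F_k` be cyclically reduced and
contain every reduced word of length `L` as a subword. Suppose `F_k` is isomorphic to an
HNN extension `A*_ψ` over an isomorphism `ψ : C → C'` of subgroups of `A`, with `C` free
of rank `r`, in such a way that the image of `h` lies in a conjugate of the canonical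
image of `A`. Then `r > (k−1)(L−2)`. -/
theorem no_small_rank_hnn_relative_to_h (k L r : ℕ) (hk : 2 ≤ k) (hL : 2 ≤ L)
    (h : FreeGroup (Fin k)) (hcyc : IsCyclicallyReduced h)
    (hall : ∀ u : List (Fin k × Bool), FreeGroup.reduce u = u → u.length = L →
      u <:+: FreeGroup.toWord h)
    (A : Type) [Group A] (C C' : Subgroup A) (ψ : C ≃* C')
    (hCfree : Nonempty (C ≃* FreeGroup (Fin r)))
    (Φ : FreeGroup (Fin k) ≃* HNNExtension A C C' ψ)
    (hell : ∃ g : HNNExtension A C C' ψ,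
      g * Φ h * g⁻¹ ∈ (HNNExtension.of : A →* HNNExtension A C C' ψ).range) :
    (k - 1) * (L - 2) < r := by
  classical
  have hred : FreeGroup.IsReduced (FreeGroup.toWord h ++ FreeGroup.toWord h) :=
    FreeGroup.IsReduced.of_reduce_eq hcyc
  let _ : MulAction (FreeGroup (Fin k)) (HNNExtension.TreeVertex ψ) :=
    MulAction.compHom _ Φ.toMonoidHom
  have hsmul : ∀ (g : FreeGroup (Fin k)) (x : HNNExtension.TreeVertex ψ), g • x = Φ g • x :=
    fun _ _ => rfl
  have hsmul₂ : ∀ (g : FreeGroup (Fin k)) (p : HNNExtension.TreeVertex ψ ×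
      HNNExtension.TreeVertex ψ), g • p = Φ g • p := fun _ _ => rfl
  obtain ⟨d⟩ := HNNExtension.NormalWord.TransversalPair.nonempty A C C'
  obtain ⟨g, a, ha⟩ := hell
  obtain ⟨P, hP, hmeet, hmeet₂⟩ := FreeGroup.exists_finset_of_forall_infix hk hL hred hall
    ((g⁻¹ : HNNExtension A C C' ψ) : HNNExtension.TreeVertex ψ) (by
      rw [hsmul, MulAction.Quotient.smul_mk, QuotientGroup.eq]
      exact ⟨a⁻¹, by rw [map_inv, ha, smul_eq_mul]; group⟩)
  obtain ⟨i₀, hi₀⟩ : ∃ i, HNNExtension.exponent ψ (Φ (FreeGroup.of i)) ≠ 1 := by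
    by_contra! hi
    have hone : (HNNExtension.exponent ψ).comp Φ.toMonoidHom = 1 :=
      FreeGroup.ext_hom _ _ fun i => by simpa using hi i
    have ht := DFunLike.congr_fun hone (Φ.symm HNNExtension.t)
    have := congrArg Multiplicative.toAdd ht
    simp at this
  obtain ⟨e⟩ := hCfree
  let eC : C ≃* MulAction.stabilizer (HNNExtension A C C' ψ) (HNNExtension.treeEdge ψ) :=
    (C.equivMapOfInjective _ (HNNExtension.of_injective ψ)).trans
      (MulEquiv.subgroupCongr (HNNExtension.stabilizer_treeEdge ψ).symm)
  let eF : MulAction.stabilizer (FreeGroup (Fin k)) (HNNExtension.treeEdge ψ) ≃*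
      MulAction.stabilizer (HNNExtension A C C' ψ) (HNNExtension.treeEdge ψ) :=
    { toFun := fun x => ⟨Φ x, x.2⟩
      invFun := fun x => ⟨Φ.symm x, by
        rw [MulAction.mem_stabilizer_iff, hsmul₂, Φ.apply_symm_apply]
        exact x.2⟩
      left_inv := fun x => by simp
      right_inv := fun x => by simp
      map_mul' := fun x y => Subtype.ext (map_mul Φ x.1 y.1) }
  refine OrientedTree.mul_lt_of_edge_transitive (T := HNNExtension.bassSerreTree ψ d) hk hL
    ?_ (HNNExtension.treeEdge ψ) ?_ ((eF.trans eC.symm).trans e) i₀ ?_ hP hmeet hmeet₂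
  · rintro g x y ⟨b, hb⟩
    exact ⟨Φ g * b, by rw [mul_smul, hb]; rfl⟩
  · rintro x y ⟨b, hb⟩
    exact ⟨Φ.symm b, by rw [hsmul₂, Φ.apply_symm_apply, hb]⟩
  · intro n hn x hx
    rw [hsmul] at hx
    have := HNNExtension.exponent_eq_one_of_smul_eq ψ hx
    rw [map_pow, map_pow] at this
    exact hi₀ ((pow_eq_one_iff_left hn.ne').1 this)
end

section
/- For each integer k ≥ 2 and each even integer L ≥ 2, there exist: groups A, B, and C with C free of rank (k−1)(L−2)+1, injective homomorphisms i_A : C → A and i_B : C → B with i_A(C) ≠ A and i_B(C) ≠ B, an isomorphism Φ from F_k to the amalgamated free product A *_C B, and a cyclically reduced element h ∈ F_k containing every reduced word of length L as a subword such that Φ(h) lies in the canonical image of A in A *_C B. -/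
/-- `G` is an amalgamated free product `A *_C B` (expressed by the pushout universal
property) with both factors proper, `C` free of rank `r`, identified with `F_k` by an
isomorphism carrying `h` into the canonical image of `A`. -/
def IsAmalgamOverRankRelativeTo (k r : ℕ) (h : FreeGroup (Fin k))
    (A B C G : Type) [Group A] [Group B] [Group C] [Group G] : Prop :=
  ∃ (iA : C →* A) (iB : C →* B) (jA : A →* G) (jB : B →* G),
    Function.Injective iA ∧ Function.Injective iB ∧
    iA.range ≠ ⊤ ∧ iB.range ≠ ⊤ ∧
    jA.comp iA = jB.comp iB ∧
    (∀ (K : Type) [Group K], ∀ (fA : A →* K) (fB : B →* K),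
      fA.comp iA = fB.comp iB → ∃! f : G →* K, f.comp jA = fA ∧ f.comp jB = fB) ∧
    Nonempty (C ≃* FreeGroup (Fin r)) ∧
    ∃ (Φ : FreeGroup (Fin k) ≃* G), Φ h ∈ jA.range

namespace DihedralSplitting

open FreeGroup hiding map_mul map_inv map_one

/-- The action on `ℤ` of a letter of type `t`: letters of type `true` swap `2j` and `2j + 1`,
letters of type `false` swap `2j` and `2j - 1`. -/
def step (t : Bool) (i : ℤ) : ℤ := if t = decide (i % 2 = 0) then i + 1 else i - 1

lemma step_true (i : ℤ) : step true i = if i % 2 = 0 then i + 1 else i - 1 := by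
  simp [step]

lemma step_false (i : ℤ) : step false i = if i % 2 = 0 then i - 1 else i + 1 := by
  by_cases h : i % 2 = 0 <;> simp [step, h]

lemma step_eq_or (t : Bool) (i : ℤ) : step t i = i + 1 ∨ step t i = i - 1 := by
  unfold step; split_ifs <;> simp

lemma step_step (t : Bool) (i : ℤ) : step t (step t i) = i := by
  cases t
  · simp only [step_false]; split_ifs <;> omega
  · simp only [step_true]; split_ifs <;> omega

lemma step_one_sub (t : Bool) (i : ℤ) : step t (1 - i) = 1 - step t i := by
  cases t
  · simp only [step_false]; split_ifs <;> omega
  · simp only [step_true]; split_ifs <;> omega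

lemma step_neg_one_sub (t : Bool) (i : ℤ) : step t (-1 - i) = -1 - step t i := by
  cases t
  · simp only [step_false]; split_ifs <;> omega
  · simp only [step_true]; split_ifs <;> omega

lemma step_add_two_mul (t : Bool) (i m : ℤ) : step t (i + 2 * m) = step t i + 2 * m := by
  cases t
  · simp only [step_false]; split_ifs <;> omega
  · simp only [step_true]; split_ifs <;> omega

lemma eq_true_of_step_zero {t : Bool} (h : step t 0 = 1) : t = true := by
  cases t
  · simp [step_false] at h
  · rfl

lemma eq_true_of_step_one {t : Bool} (h : step t 1 = 0) : t = true := by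
  cases t
  · simp [step_false] at h
  · rfl

lemma eq_false_of_step_zero {t : Bool} (h : step t 0 = -1) : t = false := by
  cases t
  · rfl
  · simp [step_true] at h

lemma eq_false_of_step_neg_one {t : Bool} (h : step t (-1) = 0) : t = false := by
  cases t
  · rfl
  · simp [step_true] at h

lemma exists_step_eq_add_one (i : ℤ) : ∃ t, step t i = i + 1 :=
  ⟨decide (i % 2 = 0), by simp [step]⟩

lemma exists_step_eq_sub_one (i : ℤ) : ∃ t, step t i = i - 1 :=
  ⟨!decide (i % 2 = 0), by simp [step]⟩

lemma step_inj_type {s t : Bool} {i : ℤ} (h : step s i = step t i) : s = t := by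
  cases s <;> cases t <;> simp only [step_true, step_false] at h <;>
    first | rfl | (split_ifs at h <;> omega)

variable {X : Type} (ty : X → Bool) (rep : Bool → X)

/-- The positive word of length `m` in the two letters `rep true` and `rep false`, alternating and
starting with `rep t`. -/
def altWord : Bool → ℕ → FreeGroup X
  | _, 0 => 1
  | t, m + 1 => of (rep t) * altWord (!t) m

/-- The alternating positive word leading from `0` to `i`. -/
def geodesic (i : ℤ) : FreeGroup X :=
  if 0 ≤ i then altWord rep true i.toNat else altWord rep false (-i).toNat

@[simp] lemma geodesic_zero : geodesic rep 0 = 1 := by simp [geodesic, altWord]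

lemma geodesic_of_pos {i : ℤ} (hi : 1 ≤ i) :
    geodesic rep i = of (rep true) * geodesic rep (1 - i) := by
  obtain ⟨m, rfl⟩ : ∃ m : ℕ, i = m + 1 := ⟨(i - 1).toNat, by omega⟩
  rcases m with _ | m
  · simp [geodesic, altWord]
  · have h1 : (0 : ℤ) ≤ ((m + 1 : ℕ) : ℤ) + 1 := by omega
    have h2 : ¬ (0 : ℤ) ≤ 1 - (((m + 1 : ℕ) : ℤ) + 1) := by omega
    have e1 : (((m + 1 : ℕ) : ℤ) + 1).toNat = m + 1 + 1 := by omega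
    have e2 : (-(1 - (((m + 1 : ℕ) : ℤ) + 1))).toNat = m + 1 := by omega
    rw [geodesic, geodesic, if_pos h1, if_neg h2, e1, e2]
    rfl

lemma geodesic_of_neg {i : ℤ} (hi : i ≤ -1) :
    geodesic rep i = of (rep false) * geodesic rep (-1 - i) := by
  obtain ⟨m, rfl⟩ : ∃ m : ℕ, i = -(m + 1) := ⟨(-i - 1).toNat, by omega⟩
  have h1 : ¬ (0 : ℤ) ≤ -((m : ℤ) + 1) := by omega
  have h2 : (0 : ℤ) ≤ -1 - -((m : ℤ) + 1) := by omega
  have e1 : (- -((m : ℤ) + 1)).toNat = m + 1 := by omega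
  have e2 : (-1 - -((m : ℤ) + 1)).toNat = m := by omega
  rw [geodesic, geodesic, if_neg h1, if_pos h2, e1, e2]
  rfl

@[simp] lemma geodesic_one : geodesic rep 1 = of (rep true) := by
  simp [geodesic_of_pos rep le_rfl]

@[simp] lemma geodesic_neg_one : geodesic rep (-1) = of (rep false) := by
  simp [geodesic_of_neg rep le_rfl]

lemma geodesic_step (t : Bool) (i : ℤ) (h : |i| < |step t i|) :
    geodesic rep (step t i) = geodesic rep i * of (rep t) := by
  induction hm : i.natAbs using Nat.strong_induction_on generalizing i with
  | _ m ih =>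
    have h1 := step_eq_or t i
    rcases lt_trichotomy i 0 with hi | rfl | hi
    · have h2 : step t i = i - 1 := by
        rcases h1 with h1 | h1
        · rw [h1, abs_of_neg hi, abs_of_nonpos (by omega)] at h
          omega
        · exact h1
      have h3 := step_neg_one_sub t i
      rw [geodesic_of_neg rep (i := step t i) (by omega), geodesic_of_neg rep (i := i) (by omega),
        ← h3, ih _ (by omega) (-1 - i) _ rfl, mul_assoc]
      rw [h3, h2, abs_of_nonneg (by omega), abs_of_nonneg (by omega)]
      omega
    · rcases h1 with h1 | h1
      · obtain rfl := eq_true_of_step_zero h1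
        simp [h1]
      · obtain rfl := eq_false_of_step_zero h1
        simp [h1]
    · have h2 : step t i = i + 1 := by
        rcases h1 with h1 | h1
        · exact h1
        · rw [h1, abs_of_pos hi, abs_of_nonneg (by omega)] at h
          omega
      have h3 := step_one_sub t i
      rw [geodesic_of_pos rep (i := step t i) (by omega), geodesic_of_pos rep (i := i) (by omega),
        ← h3, ih _ (by omega) (1 - i) _ rfl, mul_assoc]
      rw [h3, h2, abs_of_nonpos (by omega), abs_of_nonpos (by omega)]
      omega

/-- The closed path at `0` which runs along the edge labelled `x` starting at `i`. -/
def edgeLoop (i : ℤ) (x : X) : FreeGroup X :=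
  geodesic rep i * of x * (geodesic rep (step (ty x) i))⁻¹

lemma edgeLoop_of_pos {i : ℤ} {x : X} (hi : 1 ≤ i) (hx : 1 ≤ step (ty x) i) :
    edgeLoop ty rep i x = of (rep true) * edgeLoop ty rep (1 - i) x * (of (rep true))⁻¹ := by
  rw [edgeLoop, edgeLoop, geodesic_of_pos rep hi, geodesic_of_pos rep hx, step_one_sub]
  group

lemma edgeLoop_of_neg {i : ℤ} {x : X} (hi : i ≤ -1) (hx : step (ty x) i ≤ -1) :
    edgeLoop ty rep i x = of (rep false) * edgeLoop ty rep (-1 - i) x * (of (rep false))⁻¹ := by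
  rw [edgeLoop, edgeLoop, geodesic_of_neg rep hi, geodesic_of_neg rep hx, step_neg_one_sub]
  group

variable {ty rep}

lemma edgeLoop_mem_of_cross_right (hrep : ∀ t, ty (rep t) = t) {H : Subgroup (FreeGroup X)}
    (hH : ∀ x, ty x = true → of x ∈ H) {i : ℤ} {x : X}
    (h : i = 0 ∧ step (ty x) i = 1 ∨ i = 1 ∧ step (ty x) i = 0) : edgeLoop ty rep i x ∈ H := by
  have hr := hH (rep true) (hrep _)
  rcases h with ⟨rfl, h⟩ | ⟨rfl, h⟩
  · have hx := hH x (eq_true_of_step_zero h)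
    simpa [edgeLoop, h] using H.mul_mem hx (H.inv_mem hr)
  · have hx := hH x (eq_true_of_step_one h)
    simpa [edgeLoop, h] using H.mul_mem hr hx

lemma edgeLoop_mem_of_cross_left (hrep : ∀ t, ty (rep t) = t) {H : Subgroup (FreeGroup X)}
    (hH : ∀ x, ty x = false → of x ∈ H) {i : ℤ} {x : X}
    (h : i = 0 ∧ step (ty x) i = -1 ∨ i = -1 ∧ step (ty x) i = 0) : edgeLoop ty rep i x ∈ H := by
  have hr := hH (rep false) (hrep _)
  rcases h with ⟨rfl, h⟩ | ⟨rfl, h⟩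
  · have hx := hH x (eq_false_of_step_zero h)
    simpa [edgeLoop, h] using H.mul_mem hx (H.inv_mem hr)
  · have hx := hH x (eq_false_of_step_neg_one h)
    simpa [edgeLoop, h] using H.mul_mem hr hx

/-- If two subgroups contain the letters of type `true` and `false` respectively, and contain the
same loops of the segment, then they contain all loops of the segment. -/
lemma edgeLoop_mem_of_iff (hrep : ∀ t, ty (rep t) = t) {H K : Subgroup (FreeGroup X)}
    (hH : ∀ x, ty x = true → of x ∈ H) (hK : ∀ x, ty x = false → of x ∈ K) {n : ℤ}
    (hHK : ∀ i x, i ∈ Set.Icc (-n) (n - 1) → step (ty x) i ∈ Set.Icc (-n) (n - 1) →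
      (edgeLoop ty rep i x ∈ H ↔ edgeLoop ty rep i x ∈ K)) (i : ℤ) (x : X)
    (hi : i ∈ Set.Icc (-n) (n - 1)) (hx : step (ty x) i ∈ Set.Icc (-n) (n - 1)) :
    edgeLoop ty rep i x ∈ H := by
  induction hm : i.natAbs using Nat.strong_induction_on generalizing i with
  | _ m ih =>
    have hi' := hi
    have hx' := hx
    simp only [Set.mem_Icc] at hi' hx'
    have h1 := step_eq_or (ty x) i
    by_cases hp : 1 ≤ i ∧ 1 ≤ step (ty x) i
    · rw [edgeLoop_of_pos ty rep hp.1 hp.2]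
      have hr := hH (rep true) (hrep _)
      refine H.mul_mem (H.mul_mem hr (ih _ ?_ (1 - i) ?_ ?_ rfl)) (H.inv_mem hr)
      · omega
      · simp only [Set.mem_Icc]; omega
      · rw [step_one_sub]; simp only [Set.mem_Icc]; omega
    by_cases hq : i ≤ -1 ∧ step (ty x) i ≤ -1
    · rw [hHK i x hi hx, edgeLoop_of_neg ty rep hq.1 hq.2]
      have hr := hK (rep false) (hrep _)
      have m1 : -1 - i ∈ Set.Icc (-n) (n - 1) := by simp only [Set.mem_Icc]; omega
      have m2 : step (ty x) (-1 - i) ∈ Set.Icc (-n) (n - 1) := by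
        rw [step_neg_one_sub]; simp only [Set.mem_Icc]; omega
      exact K.mul_mem (K.mul_mem hr ((hHK _ _ m1 m2).1 (ih _ (by omega) _ m1 m2 rfl)))
        (K.inv_mem hr)
    by_cases hc : i = 0 ∧ step (ty x) i = 1 ∨ i = 1 ∧ step (ty x) i = 0
    · exact edgeLoop_mem_of_cross_right hrep hH hc
    · rw [hHK i x hi hx]
      exact edgeLoop_mem_of_cross_left hrep hK (by omega)

section Segment

variable [Fintype X] (ty : X → Bool) (rep : Bool → X) (n : ℤ)

/-- The edges of the segment `[-n, n - 1]`. -/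
noncomputable def segmentEdges : Finset (ℤ × X) :=
  (Finset.Icc (-n) (n - 1) ×ˢ Finset.univ).filter
    fun p => step (ty p.2) p.1 ∈ Finset.Icc (-n) (n - 1)

variable {n} in
lemma mem_segmentEdges {p : ℤ × X} : p ∈ segmentEdges ty n ↔
    p.1 ∈ Set.Icc (-n) (n - 1) ∧ step (ty p.2) p.1 ∈ Set.Icc (-n) (n - 1) := by
  simp [segmentEdges]

variable [DecidableEq X]

/-- The edges of the maximal tree consisting of the geodesics issuing from `0`. -/
noncomputable def treeEdges : Finset (ℤ × X) :=
  (segmentEdges ty n).filter fun p => p.2 = rep (ty p.2) ∧ |p.1| < |step (ty p.2) p.1|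

/-- The edges outside the maximal tree. -/
noncomputable def freeEdges : Finset (ℤ × X) := segmentEdges ty n \ treeEdges ty rep n

/-- The label of an edge in the fundamental group of the segment. -/
noncomputable def label (p : ℤ × X) : FreeGroup (freeEdges ty rep n) :=
  if h : p ∈ freeEdges ty rep n then of ⟨p, h⟩ else 1

/-- The action of a letter on the covering of the line with labels in the fundamental group. -/
noncomputable def letterPerm (x : X) : Equiv.Perm (ℤ × FreeGroup (freeEdges ty rep n)) where
  toFun p := (step (ty x) p.1, label ty rep n (step (ty x) p.1, x) * p.2)
  invFun p := (step (ty x) p.1, (label ty rep n (p.1, x))⁻¹ * p.2)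
  left_inv p := by simp [step_step]
  right_inv p := by simp [step_step]

/-- The action of the free group on the covering of the line. -/
noncomputable def coverAction : FreeGroup X →* Equiv.Perm (ℤ × FreeGroup (freeEdges ty rep n)) :=
  lift (letterPerm ty rep n)

lemma coverAction_of (x : X) (i : ℤ) (m : FreeGroup (freeEdges ty rep n)) :
    coverAction ty rep n (of x) (i, m) =
      (step (ty x) i, label ty rep n (step (ty x) i, x) * m) := by
  simp [coverAction, letterPerm]

lemma coverAction_of_inv (x : X) (i : ℤ) (m : FreeGroup (freeEdges ty rep n)) :
    coverAction ty rep n (of x)⁻¹ (i, m) = (step (ty x) i, (label ty rep n (i, x))⁻¹ * m) := by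
  rw [map_inv, coverAction, lift_apply_of]
  rfl

/-- The inclusion of the fundamental group of the segment in the free group. -/
noncomputable def segmentHom : FreeGroup (freeEdges ty rep n) →* FreeGroup X :=
  lift fun p => edgeLoop ty rep p.1.1 p.1.2

/-- The fundamental group of the segment. -/
noncomputable def segmentGroup : Subgroup (FreeGroup X) := (segmentHom ty rep n).range

variable {ty rep n}

lemma label_of_tree (hrep : ∀ t, ty (rep t) = t) {i : ℤ} {t : Bool} (h : |i| < |step t i|) :
    label ty rep n (i, rep t) = 1 := by
  rw [label, dif_neg]
  simp only [freeEdges, treeEdges, Finset.mem_sdiff, Finset.mem_filter, hrep]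
  tauto

lemma coverAction_geodesic_inv (hrep : ∀ t, ty (rep t) = t) (i : ℤ)
    (m : FreeGroup (freeEdges ty rep n)) :
    coverAction ty rep n (geodesic rep i)⁻¹ (0, m) = (i, m) := by
  have key : ∀ (j : ℤ) (t : Bool), |j| < |step t j| →
      coverAction ty rep n (geodesic rep j)⁻¹ (0, m) = (j, m) →
      coverAction ty rep n (geodesic rep (step t j))⁻¹ (0, m) = (step t j, m) := by
    intro j t hj ih
    rw [geodesic_step rep t j hj, mul_inv_rev, map_mul, Equiv.Perm.mul_apply, ih,
      coverAction_of_inv, label_of_tree hrep hj, hrep]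
    simp
  induction i using Int.induction_on with
  | zero => simp
  | succ i ih =>
    obtain ⟨t, ht⟩ := exists_step_eq_add_one (i : ℤ)
    have := key i t (by rw [ht, abs_of_nonneg (by omega), abs_of_nonneg (by omega)]; omega) ih
    rwa [ht] at this
  | pred i ih =>
    obtain ⟨t, ht⟩ := exists_step_eq_sub_one (-(i : ℤ))
    have := key _ t (by rw [ht, abs_of_nonpos (by omega), abs_of_nonpos (by omega)]; omega) ih
    rwa [ht] at this

lemma coverAction_geodesic (hrep : ∀ t, ty (rep t) = t) (i : ℤ)
    (m : FreeGroup (freeEdges ty rep n)) :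
    coverAction ty rep n (geodesic rep i) (i, m) = (0, m) := by
  rw [← coverAction_geodesic_inv hrep i m, ← Equiv.Perm.mul_apply, ← map_mul]
  simp

lemma coverAction_edgeLoop (hrep : ∀ t, ty (rep t) = t) (i : ℤ) (x : X)
    (m : FreeGroup (freeEdges ty rep n)) :
    coverAction ty rep n (edgeLoop ty rep i x) (0, m) = (0, label ty rep n (i, x) * m) := by
  rw [edgeLoop, map_mul, map_mul, Equiv.Perm.mul_apply, Equiv.Perm.mul_apply,
    coverAction_geodesic_inv hrep, coverAction_of, step_step, coverAction_geodesic hrep]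

lemma coverAction_segmentHom (hrep : ∀ t, ty (rep t) = t)
    (g m : FreeGroup (freeEdges ty rep n)) :
    coverAction ty rep n (segmentHom ty rep n g) (0, m) = (0, g * m) := by
  induction g using FreeGroup.induction_on generalizing m with
  | C1 => simp
  | of p =>
    rw [segmentHom, lift_apply_of, coverAction_edgeLoop hrep, label, dif_pos p.2]
  | inv_of p ih =>
    rw [map_inv, map_inv, Equiv.Perm.inv_eq_iff_eq, ih]
    simp
  | mul g h ihg ihh => rw [map_mul, map_mul, Equiv.Perm.mul_apply, ihh, ihg, mul_assoc]

lemma segmentHom_injective (hrep : ∀ t, ty (rep t) = t) :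
    Function.Injective (segmentHom ty rep n) := by
  intro g h hgh
  have := coverAction_segmentHom hrep g 1
  rw [hgh, coverAction_segmentHom hrep] at this
  simpa using this.symm

lemma of_notMem_segmentGroup (hrep : ∀ t, ty (rep t) = t) (x : X) :
    of x ∉ segmentGroup ty rep n := by
  rintro ⟨g, hg⟩
  have := coverAction_segmentHom hrep g 1
  rw [hg, coverAction_of, Prod.mk.injEq] at this
  have := step_eq_or (ty x) 0
  omega

lemma edgeLoop_mem_segmentGroup {i : ℤ} {x : X} (hi : i ∈ Set.Icc (-n) (n - 1))
    (hx : step (ty x) i ∈ Set.Icc (-n) (n - 1)) :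
    edgeLoop ty rep i x ∈ segmentGroup ty rep n := by
  by_cases h : (i, x) ∈ freeEdges ty rep n
  · exact ⟨of ⟨(i, x), h⟩, by simp [segmentHom]⟩
  · have hs : (i, x) ∈ segmentEdges ty n := (mem_segmentEdges ty).2 ⟨hi, hx⟩
    rw [freeEdges, Finset.mem_sdiff, not_and_not_right, treeEdges, Finset.mem_filter] at h
    obtain ⟨-, h1, h2⟩ := h hs
    have h3 := geodesic_step rep _ _ h2
    rw [← h1] at h3
    have : edgeLoop ty rep i x = 1 := by
      rw [edgeLoop, h3, mul_inv_cancel]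
    rw [this]
    exact one_mem _

lemma segmentGroup_le {H : Subgroup (FreeGroup X)}
    (h : ∀ i x, i ∈ Set.Icc (-n) (n - 1) → step (ty x) i ∈ Set.Icc (-n) (n - 1) →
      edgeLoop ty rep i x ∈ H) : segmentGroup ty rep n ≤ H := by
  refine range_lift_le ?_
  rintro _ ⟨⟨⟨i, x⟩, hp⟩, rfl⟩
  have := (mem_segmentEdges ty).1 (Finset.mem_sdiff.1 hp).1
  exact h i x this.1 this.2

/-- The segment group is free on the edges outside the maximal tree. -/
noncomputable def segmentEquiv (hrep : ∀ t, ty (rep t) = t) :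
    FreeGroup (freeEdges ty rep n) ≃* segmentGroup ty rep n :=
  MonoidHom.ofInjective (segmentHom_injective hrep)

end Segment

section Count

variable [Fintype X] [DecidableEq X] {ty : X → Bool} {rep : Bool → X}

lemma card_treeEdges (hrep : ∀ t, ty (rep t) = t) {n : ℕ} (hn : 1 ≤ n) :
    (treeEdges ty rep n).card + 1 = 2 * n := by
  have h0 : (0 : ℤ) ∈ Finset.Icc (-(n : ℤ)) (n - 1) := by simp; omega
  have hc : ((Finset.Icc (-(n : ℤ)) (n - 1)).erase 0).card + 1 = 2 * n := by
    rw [Finset.card_erase_add_one h0, Int.card_Icc]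
    omega
  rw [← hc]
  congr 1
  refine Finset.card_bij (fun p _ => step (ty p.2) p.1) ?_ ?_ ?_
  · rintro ⟨i, x⟩ hp
    simp only [treeEdges, Finset.mem_filter, mem_segmentEdges] at hp
    simp only [Finset.mem_erase, Finset.mem_Icc]
    refine ⟨?_, hp.1.2⟩
    intro h
    rw [h] at hp
    exact absurd hp.2.2 (by simp)
  · rintro ⟨i, x⟩ hp ⟨j, y⟩ hq h
    simp only [treeEdges, Finset.mem_filter, mem_segmentEdges] at hp hq h
    have hi : |i| < |step (ty x) i| := hp.2.2
    have hj : |j| < |step (ty y) j| := hq.2.2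
    have h1 := step_eq_or (ty x) i
    have h2 := step_eq_or (ty y) j
    have hij : i = j := by
      rw [Int.abs_eq_natAbs, Int.abs_eq_natAbs] at hi hj
      omega
    subst hij
    have := step_inj_type h
    rw [Prod.mk.injEq]
    exact ⟨by simp, by rw [hp.2.1, hq.2.1, this]⟩
  · intro j hj
    simp only [Finset.mem_erase, Finset.mem_Icc] at hj
    have key : ∃ t, |step t j| < |j| ∧ -(n : ℤ) ≤ step t j ∧ step t j ≤ n - 1 := by
      rcases lt_or_gt_of_ne hj.1 with h | h
      · obtain ⟨t, ht⟩ := exists_step_eq_add_one j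
        refine ⟨t, ?_, ?_⟩
        · rw [ht, abs_of_neg h, abs_of_nonpos (by omega)]; omega
        · omega
      · obtain ⟨t, ht⟩ := exists_step_eq_sub_one j
        refine ⟨t, ?_, ?_⟩
        · rw [ht, abs_of_pos h, abs_of_nonneg (by omega)]; omega
        · omega
    obtain ⟨t, h1, h2⟩ := key
    refine ⟨(step t j, rep t), ?_, ?_⟩
    · simp only [treeEdges, Finset.mem_filter, mem_segmentEdges, hrep, step_step]
      exact ⟨⟨h2, hj.2⟩, trivial, h1⟩
    · simp only [hrep, step_step]

lemma card_segmentEdges {n : ℕ} (hn : 1 ≤ n) {x₀ : X}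
    (h₀ : ∀ x, ty x = decide ((n : ℤ) % 2 = 0) ↔ x = x₀) :
    (segmentEdges ty n).card = 2 * n + (Fintype.card X - 1) * (2 * n - 2) := by
  have hcard : (segmentEdges ty n).card = ∑ x, ((Finset.Icc (-(n : ℤ)) (n - 1)).filter
      fun i => step (ty x) i ∈ Finset.Icc (-(n : ℤ)) (n - 1)).card := by
    rw [segmentEdges, Finset.card_filter, Finset.sum_product_right]
    simp only [Finset.card_filter]
  rw [hcard, ← Finset.add_sum_erase _ _ (Finset.mem_univ x₀)]
  have hfirst : ∀ x, ty x = decide ((n : ℤ) % 2 = 0) →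
      ((Finset.Icc (-(n : ℤ)) (n - 1)).filter
        fun i => step (ty x) i ∈ Finset.Icc (-(n : ℤ)) (n - 1)) =
        Finset.Icc (-(n : ℤ)) (n - 1) := by
    intro x hx
    refine Finset.filter_true_of_mem fun i hi => ?_
    rw [Finset.mem_Icc] at hi ⊢
    by_cases h : (n : ℤ) % 2 = 0
    · simp only [h, decide_true] at hx
      rw [hx, step_true]; split_ifs <;> omega
    · simp only [h, decide_false] at hx
      rw [hx, step_false]; split_ifs <;> omega
  have hother : ∀ x, ty x ≠ decide ((n : ℤ) % 2 = 0) →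
      ((Finset.Icc (-(n : ℤ)) (n - 1)).filter
        fun i => step (ty x) i ∈ Finset.Icc (-(n : ℤ)) (n - 1)) =
        Finset.Icc (-(n : ℤ) + 1) (n - 2) := by
    intro x hx
    ext i
    rw [Finset.mem_filter, Finset.mem_Icc, Finset.mem_Icc, Finset.mem_Icc]
    by_cases h : (n : ℤ) % 2 = 0
    · simp only [h, decide_true, ne_eq, Bool.not_eq_true] at hx
      rw [hx, step_false]; split_ifs <;> omega
    · simp only [h, decide_false, ne_eq, Bool.not_eq_false] at hx
      rw [hx, step_true]; split_ifs <;> omega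
  congr 1
  · rw [hfirst x₀ ((h₀ x₀).2 rfl), Int.card_Icc]
    omega
  · rw [Finset.sum_congr rfl (g := fun _ => 2 * n - 2), Finset.sum_const,
      Finset.card_erase_of_mem (Finset.mem_univ _), Finset.card_univ, smul_eq_mul]
    intro x hx
    rw [hother x (fun h => Finset.ne_of_mem_erase hx ((h₀ x).1 h)), Int.card_Icc]
    omega

lemma card_freeEdges (hrep : ∀ t, ty (rep t) = t) {n : ℕ} (hn : 1 ≤ n) {x₀ : X}
    (h₀ : ∀ x, ty x = decide ((n : ℤ) % 2 = 0) ↔ x = x₀) :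
    (freeEdges ty rep n).card = (Fintype.card X - 1) * (2 * n - 2) + 1 := by
  have h1 := card_treeEdges hrep hn
  have h2 := card_segmentEdges hn h₀
  have h3 : treeEdges ty rep (n : ℤ) ⊆ segmentEdges ty n := Finset.filter_subset _ _
  rw [freeEdges, Finset.card_sdiff_of_subset h3, h2]
  omega

end Count

section Words

/-- The path on the line starting at `i` and labelled by `w` stays between `lo` and `hi`. -/
def StaysIn (ty : X → Bool) (lo hi : ℤ) : ℤ → List (X × Bool) → Prop
  | i, [] => lo ≤ i ∧ i ≤ hi
  | i, l :: w => (lo ≤ i ∧ i ≤ hi) ∧ StaysIn ty lo hi (step (ty l.1) i) w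

variable {ty : X → Bool} {rep : Bool → X}

lemma StaysIn.start {lo hi i : ℤ} {w : List (X × Bool)} (h : StaysIn ty lo hi i w) :
    lo ≤ i ∧ i ≤ hi := by
  cases w with
  | nil => exact h
  | cons l w => exact h.1

lemma StaysIn.mono {lo hi lo' hi' : ℤ} (hlo : lo' ≤ lo) (hhi : hi ≤ hi') {i : ℤ}
    {w : List (X × Bool)} (h : StaysIn ty lo hi i w) : StaysIn ty lo' hi' i w := by
  induction w generalizing i with
  | nil => exact ⟨hlo.trans h.1, h.2.trans hhi⟩
  | cons l w ih => exact ⟨⟨hlo.trans h.1.1, h.1.2.trans hhi⟩, ih h.2⟩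

lemma StaysIn.shift {lo hi : ℤ} (m : ℤ) {i : ℤ} {w : List (X × Bool)}
    (h : StaysIn ty lo hi i w) : StaysIn ty (lo + 2 * m) (hi + 2 * m) (i + 2 * m) w := by
  induction w generalizing i with
  | nil => exact ⟨by linarith [h.1], by linarith [h.2]⟩
  | cons l w ih =>
    refine ⟨⟨by linarith [h.1.1], by linarith [h.1.2]⟩, ?_⟩
    rw [step_add_two_mul]
    exact ih h.2

lemma exists_staysIn (i : ℤ) (w : List (X × Bool)) :
    ∃ lo, StaysIn ty lo (lo + w.length) i w := by
  induction w generalizing i with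
  | nil => exact ⟨i, by simp [StaysIn]⟩
  | cons l w ih =>
    obtain ⟨lo, hlo⟩ := ih (step (ty l.1) i)
    have h1 := hlo.start
    have h2 := step_eq_or (ty l.1) i
    rw [List.length_cons]
    by_cases h : i < lo
    · exact ⟨lo - 1, ⟨by omega, by push_cast; omega⟩, hlo.mono (by omega) (by push_cast; omega)⟩
    · exact ⟨lo, ⟨by omega, by push_cast; omega⟩, hlo.mono (by omega) (by push_cast; omega)⟩

variable [Fintype X] [DecidableEq X]

/-- The vertex group generated by the segment group and the letters of type `t`. -/
noncomputable def vertexGroup (ty : X → Bool) (rep : Bool → X) (n : ℤ) (t : Bool) : Subgroup (FreeGroup X) :=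
  Subgroup.closure (of '' {x | ty x = t}) ⊔ segmentGroup ty rep n

lemma of_mem_vertexGroup {n : ℤ} {t : Bool} {x : X} (hx : ty x = t) :
    of x ∈ vertexGroup ty rep n t :=
  Subgroup.mem_sup_left (Subgroup.subset_closure ⟨x, hx, rfl⟩)

lemma segmentGroup_le_vertexGroup (n : ℤ) (t : Bool) :
    segmentGroup ty rep n ≤ vertexGroup ty rep n t := le_sup_right

lemma vertexGroup_le {n : ℤ} {t : Bool} {H : Subgroup (FreeGroup X)}
    (h1 : ∀ x, ty x = t → of x ∈ H) (h2 : segmentGroup ty rep n ≤ H) :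
    vertexGroup ty rep n t ≤ H := by
  refine sup_le ((Subgroup.closure_le _).2 ?_) h2
  rintro _ ⟨x, hx, rfl⟩
  exact h1 x hx

variable {n : ℤ}

lemma edgeLoop_mem_vertexGroup (hrep : ∀ t, ty (rep t) = t) (hn : 1 ≤ n) {i : ℤ} {x : X}
    (hi : i ∈ Set.Icc (-n) (n + 1)) (hx : step (ty x) i ∈ Set.Icc (-n) (n + 1)) :
    edgeLoop ty rep i x ∈ vertexGroup ty rep n true := by
  rw [Set.mem_Icc] at hi hx
  have h1 := step_eq_or (ty x) i
  by_cases hp : 1 ≤ i ∧ 1 ≤ step (ty x) i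
  · rw [edgeLoop_of_pos ty rep hp.1 hp.2]
    have hr : of (rep true) ∈ vertexGroup ty rep n true := of_mem_vertexGroup (hrep _)
    refine mul_mem (mul_mem hr (segmentGroup_le_vertexGroup n true
      (edgeLoop_mem_segmentGroup ?_ ?_))) (inv_mem hr)
    · rw [Set.mem_Icc]; omega
    · rw [step_one_sub, Set.mem_Icc]; omega
  by_cases hc : i = 0 ∧ step (ty x) i = 1 ∨ i = 1 ∧ step (ty x) i = 0
  · exact edgeLoop_mem_of_cross_right hrep (fun y hy => of_mem_vertexGroup hy) hc
  · refine segmentGroup_le_vertexGroup n true (edgeLoop_mem_segmentGroup ?_ ?_) <;>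
    rw [Set.mem_Icc] <;> omega

lemma letter_mem_vertexGroup (hrep : ∀ t, ty (rep t) = t) (hn : 1 ≤ n) {i : ℤ} (l : X × Bool)
    (hi : i ∈ Set.Icc (-n) (n + 1)) (hl : step (ty l.1) i ∈ Set.Icc (-n) (n + 1)) :
    geodesic rep i * mk [l] * (geodesic rep (step (ty l.1) i))⁻¹ ∈ vertexGroup ty rep n true := by
  obtain ⟨x, b⟩ := l
  cases b
  · have h := inv_mem (edgeLoop_mem_vertexGroup hrep hn (x := x) hl (by rwa [step_step]))
    rw [edgeLoop, step_step, mul_inv_rev, mul_inv_rev, inv_inv, ← mul_assoc] at h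
    exact h
  · exact edgeLoop_mem_vertexGroup hrep hn hi hl

lemma StaysIn.mem_vertexGroup (hrep : ∀ t, ty (rep t) = t) (hn : 1 ≤ n) {i : ℤ}
    {w : List (X × Bool)} (h : StaysIn ty (-n) (n + 1) i w) :
    ∃ j ∈ Set.Icc (-n) (n + 1),
      geodesic rep i * mk w * (geodesic rep j)⁻¹ ∈ vertexGroup ty rep n true := by
  induction w generalizing i with
  | nil => exact ⟨i, h, by simp [← one_eq_mk, one_mem]⟩
  | cons l w ih =>
    obtain ⟨j, hj, hm⟩ := ih h.2
    refine ⟨j, hj, ?_⟩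
    have := mul_mem (letter_mem_vertexGroup hrep hn l h.1 h.2.start) hm
    rw [← List.singleton_append, ← mul_mk]
    simpa only [mul_assoc, mul_inv_rev, inv_inv, inv_mul_cancel_left] using this

lemma exists_fold (hrep : ∀ t, ty (rep t) = t) {i : ℤ} (hi : i ∈ Set.Icc (-n) (n + 1)) :
    ∃ j ∈ Set.Icc (-n) 0, geodesic rep j * (geodesic rep i)⁻¹ ∈ vertexGroup ty rep n true := by
  rw [Set.mem_Icc] at hi
  by_cases h : i ≤ 0
  · exact ⟨i, ⟨hi.1, h⟩, by simp [one_mem]⟩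
  · refine ⟨1 - i, by rw [Set.mem_Icc]; omega, ?_⟩
    rw [geodesic_of_pos rep (i := i) (by omega), mul_inv_rev, mul_inv_cancel_left]
    exact inv_mem (of_mem_vertexGroup (hrep _))

lemma exists_reading (hrep : ∀ t, ty (rep t) = t) (hn : 1 ≤ n) {w : List (X × Bool)}
    (hw : (w.length : ℤ) = 2 * n) : ∃ i ∈ Set.Icc (-n) 0, ∃ j ∈ Set.Icc (-n) 0,
      geodesic rep i * mk w * (geodesic rep j)⁻¹ ∈ vertexGroup ty rep n true := by
  obtain ⟨lo, hlo⟩ := exists_staysIn (ty := ty) 0 w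
  have h2 : ∃ m, -n ≤ lo + 2 * m ∧ lo + 2 * m ≤ -n + 1 := ⟨(-n + 1 - lo) / 2, by omega, by omega⟩
  obtain ⟨m, hm⟩ := h2
  have h3 := (hlo.shift m).mono (lo' := -n) (hi' := n + 1) (by omega) (by omega)
  obtain ⟨j, hj, hr⟩ := h3.mem_vertexGroup hrep hn
  obtain ⟨i', hi', hri⟩ := exists_fold hrep (n := n) h3.start
  obtain ⟨j', hj', hrj⟩ := exists_fold hrep hj
  refine ⟨i', hi', j', hj', ?_⟩
  have := mul_mem (mul_mem hri hr) (inv_mem hrj)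
  simpa only [mul_assoc, mul_inv_rev, inv_inv, inv_mul_cancel_left] using this

/-- Every reduced word can be extended to the left to a reduced word which is read in the graph of
the vertex group starting at the base point with a prescribed first letter. -/
lemma exists_prefix (hrep : ∀ t, ty (rep t) = t) (hn : 1 ≤ n) (σ : Bool) {i : ℤ}
    (hi : i ∈ Set.Icc (-n) 0) {w : List (X × Bool)} (hw : IsReduced w) :
    ∃ p, IsReduced ((rep true, σ) :: p ++ w) ∧
      mk ((rep true, σ) :: p) * (geodesic rep i)⁻¹ ∈ vertexGroup ty rep n true := by
  have hsign : ∃ b : Bool, ∀ y, IsReduced ((y, b) :: w) := by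
    cases w with
    | nil => exact ⟨true, fun _ => IsReduced.singleton⟩
    | cons l w => exact ⟨l.2, fun y => by rw [isReduced_cons_cons]; exact ⟨fun _ => rfl, hw⟩⟩
  obtain ⟨b, hb⟩ := hsign
  have hne : rep true ≠ rep false := fun h => by simpa [hrep] using congrArg ty h
  induction hm : i.natAbs generalizing i w b with
  | zero =>
    obtain rfl : i = 0 := by omega
    refine ⟨[(rep false, b), (rep false, b)], ?_, ?_⟩
    · simp only [List.cons_append, List.nil_append, isReduced_cons_cons]
      exact ⟨fun h => absurd h hne, fun _ => trivial, hb _⟩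
    · have s0 : step (ty (rep false)) 0 = -1 := by rw [hrep]; rfl
      have s1 : step (ty (rep false)) (-1) = 0 := by rw [hrep]; rfl
      have m0 := letter_mem_vertexGroup hrep hn (i := 0) (rep false, b)
        (by rw [Set.mem_Icc]; omega) (by rw [s0, Set.mem_Icc]; omega)
      have m1 := letter_mem_vertexGroup hrep hn (i := -1) (rep false, b)
        (by rw [Set.mem_Icc]; omega) (by rw [s1, Set.mem_Icc]; omega)
      have m2 : mk [(rep true, σ)] ∈ vertexGroup ty rep n true := by
        have h : of (rep true) ∈ vertexGroup ty rep n true := of_mem_vertexGroup (hrep _)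
        cases σ
        · exact inv_mem h
        · exact h
      rw [s0] at m0
      rw [s1] at m1
      have := mul_mem m2 (mul_mem m0 m1)
      simpa [mul_assoc] using this
  | succ m ih =>
    rw [Set.mem_Icc] at hi
    obtain ⟨t, ht⟩ := exists_step_eq_add_one i
    have ht' : step (ty (rep t)) (i + 1) = i := by rw [hrep, ← ht, step_step]
    obtain ⟨p, hp1, hp2⟩ := ih (i := i + 1) (by rw [Set.mem_Icc]; omega) (hb (rep t)) b
      (fun y => by rw [isReduced_cons_cons]; exact ⟨fun _ => rfl, hb _⟩) (by omega)
    refine ⟨p ++ [(rep t, b)], by simpa using hp1, ?_⟩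
    have h := letter_mem_vertexGroup hrep hn (i := i + 1) (rep t, b)
      (by rw [Set.mem_Icc]; omega) (by rw [ht', Set.mem_Icc]; omega)
    rw [ht'] at h
    have := mul_mem hp2 h
    rw [← List.cons_append, ← mul_mk]
    simpa only [mul_assoc, mul_inv_rev, inv_inv, inv_mul_cancel_left] using this

lemma exists_loop (hrep : ∀ t, ty (rep t) = t) (hn : 1 ≤ n) {w : List (X × Bool)}
    (hr : IsReduced w) (hw : (w.length : ℤ) = 2 * n) :
    ∃ v, w <:+: v ∧ IsReduced v ∧ v.head? = some (rep true, true) ∧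
      v.getLast? = some (rep true, true) ∧ mk v ∈ vertexGroup ty rep n true := by
  obtain ⟨i, hi, j, hj, hm⟩ := exists_reading hrep hn hw
  obtain ⟨p, hp, hpm⟩ := exists_prefix hrep hn true hi hr
  have hp' : IsReduced (invRev ((rep true, true) :: p ++ w)) := by
    rw [isReduced_iff_reduce_eq] at hp ⊢
    rw [reduce_invRev, hp]
  obtain ⟨q, hq, hqm⟩ := exists_prefix hrep hn false hj hp'
  refine ⟨(rep true, true) :: p ++ w ++ invRev ((rep true, false) :: q), ?_, ?_, ?_, ?_, ?_⟩
  · exact ⟨_, _, rfl⟩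
  · rw [isReduced_iff_reduce_eq] at hq ⊢
    have := reduce_invRev (w := (rep true, false) :: q ++ invRev ((rep true, true) :: p ++ w))
    rwa [hq, invRev_append, invRev_invRev] at this
  · simp
  · rw [invRev_cons, ← List.append_assoc]
    exact List.getLast?_concat
  · rw [← mul_mk, ← mul_mk, ← inv_mk]
    have := mul_mem (mul_mem hpm hm) (inv_mem hqm)
    simpa only [mul_assoc, mul_inv_rev, inv_inv, inv_mul_cancel_left] using this

lemma exists_loop_of_finite (hrep : ∀ t, ty (rep t) = t) (hn : 1 ≤ n)
    {S : Set (List (X × Bool))} (hS : S.Finite)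
    (h : ∀ w ∈ S, IsReduced w ∧ (w.length : ℤ) = 2 * n) :
    ∃ v, (∀ w ∈ S, w <:+: v) ∧ IsReduced v ∧ v.head? = some (rep true, true) ∧
      v.getLast? = some (rep true, true) ∧ mk v ∈ vertexGroup ty rep n true := by
  induction S, hS using Set.Finite.induction_on with
  | empty => exact ⟨[(rep true, true)], by simp, IsReduced.singleton, rfl, rfl,
      of_mem_vertexGroup (hrep _)⟩
  | @insert w S _ _ ih =>
    obtain ⟨v, hv, hvr, hvh, hvl, hvm⟩ := ih fun u hu => h u (Set.mem_insert_of_mem _ hu)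
    obtain ⟨h1, h2⟩ := h w (Set.mem_insert _ _)
    obtain ⟨u, hu, hur, huh, hul, hum⟩ := exists_loop hrep hn h1 h2
    refine ⟨v ++ u, ?_, ?_, ?_, ?_, ?_⟩
    · rintro x (rfl | hx)
      · exact hu.trans (List.suffix_append v u).isInfix
      · exact (hv x hx).trans (List.prefix_append v u).isInfix
    · exact hvr.append hur (by simp [hvl, huh])
    · simp [List.head?_append, hvh]
    · simp [List.getLast?_append, hul]
    · rw [← mul_mk]; exact mul_mem hvm hum

end Words

section Pushout

variable [Fintype X] [DecidableEq X] {ty : X → Bool} {rep : Bool → X} {n : ℤ}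

lemma existsUnique_extension (hrep : ∀ t, ty (rep t) = t) {K : Type} [Group K]
    (fA : vertexGroup ty rep n true →* K) (fB : vertexGroup ty rep n false →* K)
    (hf : fA.comp (Subgroup.inclusion (segmentGroup_le_vertexGroup n true)) =
      fB.comp (Subgroup.inclusion (segmentGroup_le_vertexGroup n false))) :
    ∃! f : FreeGroup X →* K, f.comp (vertexGroup ty rep n true).subtype = fA ∧
      f.comp (vertexGroup ty rep n false).subtype = fB := by
  let f : FreeGroup X →* K := lift fun x =>
    if h : ty x = true then fA ⟨of x, of_mem_vertexGroup h⟩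
    else fB ⟨of x, of_mem_vertexGroup (Bool.eq_false_iff.2 h)⟩
  let EA : Subgroup (FreeGroup X) :=
    ((f.comp (vertexGroup ty rep n true).subtype).eqLocus fA).map (Subgroup.subtype _)
  let EB : Subgroup (FreeGroup X) :=
    ((f.comp (vertexGroup ty rep n false).subtype).eqLocus fB).map (Subgroup.subtype _)
  have memA : ∀ {g} (hg : g ∈ vertexGroup ty rep n true), g ∈ EA ↔ f g = fA ⟨g, hg⟩ := by
    intro g hg
    constructor
    · rintro ⟨⟨g, hg'⟩, h, rfl⟩
      exact h
    · exact fun h => ⟨⟨g, hg⟩, h, rfl⟩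
  have memB : ∀ {g} (hg : g ∈ vertexGroup ty rep n false), g ∈ EB ↔ f g = fB ⟨g, hg⟩ := by
    intro g hg
    constructor
    · rintro ⟨⟨g, hg'⟩, h, rfl⟩
      exact h
    · exact fun h => ⟨⟨g, hg⟩, h, rfl⟩
  have ofA : ∀ x, ty x = true → of x ∈ EA := fun x hx => by
    rw [memA (of_mem_vertexGroup hx)]
    simp [f, hx]
  have ofB : ∀ x, ty x = false → of x ∈ EB := fun x hx => by
    rw [memB (of_mem_vertexGroup hx)]
    simp [f, hx]
  have iffC : ∀ g ∈ segmentGroup ty rep n, (g ∈ EA ↔ g ∈ EB) := fun g hg => by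
    rw [memA (segmentGroup_le_vertexGroup n true hg),
      memB (segmentGroup_le_vertexGroup n false hg)]
    have : fA ⟨g, segmentGroup_le_vertexGroup n true hg⟩ =
      fB ⟨g, segmentGroup_le_vertexGroup n false hg⟩ := DFunLike.congr_fun hf ⟨g, hg⟩
    rw [this]
  have leA : segmentGroup ty rep n ≤ EA := segmentGroup_le <|
    edgeLoop_mem_of_iff hrep ofA ofB fun i x hi hx => iffC _ (edgeLoop_mem_segmentGroup hi hx)
  have leB : segmentGroup ty rep n ≤ EB := fun g hg => (iffC g hg).1 (leA hg)
  refine ⟨f, ⟨?_, ?_⟩, ?_⟩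
  · ext ⟨g, hg⟩
    exact (memA hg).1 (vertexGroup_le ofA leA hg)
  · ext ⟨g, hg⟩
    exact (memB hg).1 (vertexGroup_le ofB leB hg)
  · rintro f' ⟨hA, hB⟩
    ext x
    cases hx : ty x
    · have := DFunLike.congr_fun hB ⟨of x, of_mem_vertexGroup hx⟩
      simpa [f, hx] using this
    · have := DFunLike.congr_fun hA ⟨of x, of_mem_vertexGroup hx⟩
      simpa [f, hx] using this

lemma range_inclusion_vertexGroup_ne_top (hrep : ∀ t, ty (rep t) = t) (t : Bool) :
    (Subgroup.inclusion (segmentGroup_le_vertexGroup (ty := ty) (rep := rep) n t)).range ≠ ⊤ := by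
  intro h
  have hm : (⟨of (rep t), of_mem_vertexGroup (hrep t)⟩ : vertexGroup ty rep n t) ∈
      (Subgroup.inclusion (segmentGroup_le_vertexGroup (ty := ty) (rep := rep) n t)).range :=
    h ▸ Subgroup.mem_top _
  obtain ⟨⟨g, hg⟩, hgt⟩ := hm
  obtain rfl : g = of (rep t) := congrArg Subtype.val hgt
  exact of_notMem_segmentGroup hrep _ hg

end Pushout

/-- On at least two letters there is a type function with two nonempty classes, in which exactly one
letter has a prescribed type. -/
lemma exists_type_rep {k : ℕ} (hk : 2 ≤ k) (e : Bool) :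
    ∃ (ty : Fin k → Bool) (rep : Bool → Fin k) (x₀ : Fin k),
      (∀ t, ty (rep t) = t) ∧ ∀ x, ty x = e ↔ x = x₀ := by
  obtain ⟨x₀, x₁, h10⟩ : ∃ x₀ x₁ : Fin k, x₁ ≠ x₀ := ⟨⟨0, by omega⟩, ⟨1, by omega⟩, by simp⟩
  refine ⟨fun x => if x = x₀ then e else !e, fun t => if t = e then x₀ else x₁, x₀, fun t => ?_,
    fun x => ?_⟩
  · by_cases h : t = e
    · simp [h]
    · simpa [h, h10] using (Bool.eq_not.2 h).symm
  · by_cases h : x = x₀ <;> simp [h]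

lemma nonempty_segmentGroup_mulEquiv {k n : ℕ} {ty : Fin k → Bool} {rep : Bool → Fin k}
    (hrep : ∀ t, ty (rep t) = t) (hn : 1 ≤ n) {x₀ : Fin k}
    (h₀ : ∀ x, ty x = decide ((n : ℤ) % 2 = 0) ↔ x = x₀) :
    Nonempty (segmentGroup ty rep n ≃* FreeGroup (Fin ((k - 1) * (2 * n - 2) + 1))) := by
  have hcard := card_freeEdges hrep hn h₀
  rw [Fintype.card_fin] at hcard
  exact ⟨(segmentEquiv hrep).symm.trans
    (FreeGroup.freeGroupCongr (Finset.equivFinOfCardEq hcard))⟩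

lemma isAmalgamOverRankRelativeTo_vertexGroup {k n : ℕ} {ty : Fin k → Bool} {rep : Bool → Fin k}
    (hrep : ∀ t, ty (rep t) = t) (hn : 1 ≤ n) {x₀ : Fin k}
    (h₀ : ∀ x, ty x = decide ((n : ℤ) % 2 = 0) ↔ x = x₀) {h : FreeGroup (Fin k)}
    (hh : h ∈ vertexGroup ty rep n true) :
    IsAmalgamOverRankRelativeTo k ((k - 1) * (2 * n - 2) + 1) h (vertexGroup ty rep n true)
      (vertexGroup ty rep n false) (segmentGroup ty rep n) (FreeGroup (Fin k)) := by
  refine ⟨Subgroup.inclusion (segmentGroup_le_vertexGroup _ _),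
    Subgroup.inclusion (segmentGroup_le_vertexGroup _ _), Subgroup.subtype _, Subgroup.subtype _,
    Subgroup.inclusion_injective _, Subgroup.inclusion_injective _,
    range_inclusion_vertexGroup_ne_top hrep _, range_inclusion_vertexGroup_ne_top hrep _,
    (Subgroup.subtype_comp_inclusion _).trans (Subgroup.subtype_comp_inclusion _).symm,
    fun K _ fA fB hf => existsUnique_extension hrep fA fB hf,
    nonempty_segmentGroup_mulEquiv hrep hn h₀,
    MulEquiv.refl _, ?_⟩
  rw [Subgroup.range_subtype]
  exact hh

end DihedralSplitting

open DihedralSplitting in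
/-- For every `k ≥ 2` and every even `L ≥ 2` there is a splitting of
`F_k` as an amalgam `A *_C B` over a free group `C` of rank `(k−1)(L−2)+1`, relative to a
cyclically reduced element `h` containing every reduced word of length `L` as a subword
(the image of `h` lying in the canonical image of `A`). -/
theorem sharp_amalgam_exists (k L : ℕ) (hk : 2 ≤ k) (hL : 2 ≤ L) (hLeven : Even L) :
    ∃ (A : Type) (gA : Group A) (B : Type) (gB : Group B) (C : Type) (gC : Group C)
      (G : Type) (gG : Group G) (h : FreeGroup (Fin k)),
      IsCyclicallyReduced h ∧
      (∀ u : List (Fin k × Bool), FreeGroup.reduce u = u → u.length = L →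
        u <:+: FreeGroup.toWord h) ∧
      @IsAmalgamOverRankRelativeTo k ((k - 1) * (L - 2) + 1) h A B C G gA gB gC gG := by
  obtain ⟨n, rfl⟩ := hLeven.two_dvd
  have hn : 1 ≤ n := by omega
  obtain ⟨ty, rep, x₀, hrep, h₀⟩ := exists_type_rep hk (decide ((n : ℤ) % 2 = 0))
  have hn' : (1 : ℤ) ≤ n := by exact_mod_cast hn
  have hfin : {u : List (Fin k × Bool) | FreeGroup.IsReduced u ∧ u.length = 2 * n}.Finite :=
    (List.finite_length_eq _ (2 * n)).subset fun u hu => hu.2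
  obtain ⟨v, hv, hvr, hvh, hvl, hvm⟩ := exists_loop_of_finite hrep hn' hfin
    (fun w hw => ⟨hw.1, by rw [hw.2]; push_cast; rfl⟩)
  have hword : (FreeGroup.mk v).toWord = v := by rw [FreeGroup.toWord_mk, hvr.reduce_eq]
  refine ⟨vertexGroup ty rep n true, inferInstance, vertexGroup ty rep n false, inferInstance,
    segmentGroup ty rep n, inferInstance, FreeGroup (Fin k), inferInstance, FreeGroup.mk v,
    ?_, ?_, ?_⟩
  · rw [IsCyclicallyReduced, hword]
    exact FreeGroup.IsReduced.reduce_eq (hvr.append hvr (by simp [hvl, hvh]))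
  · intro u hu hlen
    rw [hword]
    exact hv u ⟨FreeGroup.IsReduced.of_reduce_eq hu, hlen⟩
  · exact isAmalgamOverRankRelativeTo_vertexGroup hrep hn h₀ hvm
end

section
/- Let k ≥ 2, p ≥ 1, and m ≥ 1 be integers, and let w_1, …, w_p ∈ F_k satisfy |w_i| > 2m for all i. If the 2p elements w_1^{±1}, …, w_p^{±1} have pairwise distinct m-prefixes (i.e., the map sending (i, ε) ∈ {1,…,p} × {±1} to the m-prefix of w_i^{ε} is injective), then w_1, …, w_p freely generate a free subgroup of rank p of F_k; equivalently, the homomorphism from the free group of rank p to F_k sending the i-th basis element to w_i is injective. -/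
/-- The length `|g|` of the reduced word representing `g`. -/
def wlen {k : ℕ} (g : FreeGroup (Fin k)) : ℕ := (FreeGroup.toWord g).length

/-- The reduced word of `g` (if `ε = true`) or of `g⁻¹` (if `ε = false`). -/
def signedWord {k : ℕ} (g : FreeGroup (Fin k)) (ε : Bool) : List (Fin k × Bool) :=
  FreeGroup.toWord (if ε then g else g⁻¹)

namespace FreeGroup

variable {α : Type*}

/-- Two reduced words factor as `A * C` and `C⁻¹ * B` with `A * B` reduced. -/
theorem IsReduced.exists_cancellation {L M : List (α × Bool)} (hL : IsReduced L)
    (hM : IsReduced M) :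
    ∃ A B C, L = A ++ C ∧ M = invRev C ++ B ∧ IsReduced (A ++ B) := by
  induction L with
  | nil => exact ⟨[], M, [], rfl, rfl, hM⟩
  | cons x L ih =>
    obtain ⟨A, B, C, rfl, rfl, hAB⟩ := ih (hL.infix (List.suffix_cons x L).isInfix)
    rcases A with _ | ⟨y, A⟩
    · rcases B with _ | ⟨z, B⟩
      · exact ⟨[x], [], C, rfl, rfl, .singleton⟩
      · by_cases hxz : x.1 = z.1 → x.2 = z.2
        · exact ⟨[x], z :: B, C, rfl, rfl, isReduced_cons_cons.2 ⟨hxz, hAB⟩⟩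
        · obtain ⟨a, b⟩ := x
          obtain ⟨c, d⟩ := z
          obtain ⟨rfl, hbd⟩ : a = c ∧ b ≠ d := by simpa using hxz
          obtain rfl : d = !b := by cases b <;> cases d <;> simp_all
          exact ⟨[], B, (a, b) :: C, rfl, by simp [invRev],
            hAB.infix (List.suffix_cons _ B).isInfix⟩
    · refine ⟨x :: y :: A, B, C, rfl, rfl, ?_⟩
      have hxA : IsReduced ([x] ++ y :: A) :=
        hL.infix (List.prefix_append (x :: y :: A) C).isInfix
      exact hxA.append_overlap hAB (List.cons_ne_nil y A)

variable [DecidableEq α]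

theorem exists_toWord_mul_eq (x y : FreeGroup α) :
    ∃ A B C, x.toWord = A ++ C ∧ y.toWord = invRev C ++ B ∧ (x * y).toWord = A ++ B := by
  obtain ⟨A, B, C, hx, hy, hAB⟩ :=
    (isReduced_toWord (x := x)).exists_cancellation (isReduced_toWord (x := y))
  refine ⟨A, B, C, hx, hy, ?_⟩
  have hxy : x * y = mk (A ++ B) := by
    rw [← mk_toWord (x := x), ← mk_toWord (x := y), hx, hy, ← mul_mk, ← mul_mk, ← mul_mk,
      ← inv_mk]
    group
  rw [hxy, toWord_mk, hAB.reduce_eq]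

/-- Multiplying `x` on the right by an element whose `m`-prefix differs from that of `x⁻¹`
preserves the `m`-prefix of `x`, provided that `x` has length at least `2 * m`. -/
theorem take_toWord_mul {m : ℕ} {x y : FreeGroup α} (hx : 2 * m ≤ x.toWord.length)
    (hxy : y.toWord.take m ≠ x⁻¹.toWord.take m) :
    (x * y).toWord.take m = x.toWord.take m := by
  obtain ⟨A, B, C, hAC, hCB, hAB⟩ := exists_toWord_mul_eq x y
  have hC : C.length < m := by
    by_contra! hmC
    rw [← invRev_length (L₁ := C)] at hmC
    rw [toWord_inv, hAC, hCB, invRev_append, List.take_append_of_le_length hmC,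
      List.take_append_of_le_length hmC] at hxy
    exact hxy rfl
  have hA : m ≤ A.length := by
    rw [hAC, List.length_append] at hx
    omega
  rw [hAB, hAC, List.take_append_of_le_length hA, List.take_append_of_le_length hA]

end FreeGroup

open FreeGroup

theorem signedWord_length {k : ℕ} (g : FreeGroup (Fin k)) (ε : Bool) :
    (signedWord g ε).length = wlen g := by
  cases ε <;> simp [signedWord, wlen, toWord_inv]

/-- The image of a nonempty reduced word has the same `m`-prefix as the image of its first
letter. -/
theorem take_toWord_lift_mk {ι : Type*} {k m : ℕ} {w : ι → FreeGroup (Fin k)}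
    (hlen : ∀ i, 2 * m ≤ wlen (w i))
    (hpref : Function.Injective (fun q : ι × Bool => (signedWord (w q.1) q.2).take m))
    (q : ι × Bool) (L : List (ι × Bool)) (hL : IsReduced (q :: L)) :
    (FreeGroup.lift w (mk (q :: L))).toWord.take m = (signedWord (w q.1) q.2).take m := by
  induction L generalizing q with
  | nil => rcases q with ⟨i, _ | _⟩ <;> simp [signedWord]
  | cons r L ih =>
    obtain ⟨i, ε⟩ := q
    obtain ⟨hqr, hrL⟩ := isReduced_cons_cons.1 hL
    have hprod : FreeGroup.lift w (mk ((i, ε) :: r :: L)) =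
        (if ε then w i else (w i)⁻¹) * FreeGroup.lift w (mk (r :: L)) := by
      cases ε <;> simp
    have hinv : (if ε then w i else (w i)⁻¹)⁻¹.toWord = signedWord (w i) (!ε) := by
      cases ε <;> simp [signedWord]
    rw [hprod]
    refine take_toWord_mul ((hlen i).trans_eq (signedWord_length (w i) ε).symm) ?_
    rw [ih r hrL, hinv]
    intro h
    obtain rfl : r = (i, !ε) := hpref h
    simp at hqr

/-- Let `k ≥ 2`, `p ≥ 1`, `m ≥ 1`, and let `w_1, …, w_p ∈ F_k` with
`|w_i| > 2m` for all `i`. If the `2p` elements `w_i^{±1}` have pairwise distinct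
`m`-prefixes, then `w_1, …, w_p` freely generate a free subgroup of rank `p`: the
homomorphism `F_p → F_k` sending the `i`-th basis element to `w_i` is injective. -/
theorem free_basis_of_distinct_prefixes (k p m : ℕ) (hk : 2 ≤ k) (hp : 1 ≤ p)
    (hm : 1 ≤ m) (w : Fin p → FreeGroup (Fin k))
    (hlen : ∀ i : Fin p, 2 * m < wlen (w i))
    (hpref : Function.Injective
      (fun q : Fin p × Bool => (signedWord (w q.1) q.2).take m)) :
    Function.Injective (FreeGroup.lift w : FreeGroup (Fin p) →* FreeGroup (Fin k)) := by
  rw [injective_iff_map_eq_one]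
  intro x hx
  rw [← toWord_eq_nil_iff]
  rcases hxL : x.toWord with _ | ⟨q, L⟩
  · rfl
  · have hred : IsReduced (q :: L) := hxL ▸ isReduced_toWord
    have h := take_toWord_lift_mk (fun i => (hlen i).le) hpref q L hred
    rw [← hxL, mk_toWord, hx, toWord_one, List.take_nil] at h
    have h0 := congrArg List.length h
    rw [List.length_take, signedWord_length, List.length_nil] at h0
    have := hlen q.1
    omega
end
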